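/- arXiv:0802.3361 — 3 statements merged into one kernel-verified Lean document; each statement's English description precedes it below -/
import Mathlib

section
/- Let x, W, b ≥ 1 be integers with W even, and let h, k be nonzero integers. Then for x sufficiently large depending on W and b, the number of integers 0 < m ≤ x with m ≡ b (mod W) such that both m and |k·m + h| are prime is O_k( (x / (W log² x)) · ∏_{p | W} (1 - 1/p)^{-2} · ∏_{p | h, p ∤ W} (1 - 1/p)^{-1} ). -/
namespace BoundingSieve

open Finset ArithmeticFunction
open scoped ArithmeticFunction.Moebius

lemma sum_moebius_between {P l t : ℕ} (hP : Squarefree P) (ht : t ∣ P) :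
    (∑ d ∈ P.divisors, if l ∣ d ∧ d ∣ t then (μ d : ℝ) else 0) =
      if t = l then (μ l : ℝ) else 0 := by
  have ht0 : t ≠ 0 := ne_zero_of_dvd_ne_zero hP.ne_zero ht
  by_cases hlt : l ∣ t
  · obtain ⟨e, rfl⟩ := hlt
    have hl0 : l ≠ 0 := left_ne_zero_of_mul ht0
    have he0 : e ≠ 0 := right_ne_zero_of_mul ht0
    have hcop : l.Coprime e := Nat.coprime_of_squarefree_mul (hP.squarefree_of_dvd ht)
    have key : (∑ d ∈ P.divisors, if l ∣ d ∧ d ∣ l * e then (μ d : ℝ) else 0) =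
        ∑ c ∈ e.divisors, (μ l : ℝ) * μ c := by
      rw [← sum_filter]
      symm
      refine sum_bij (fun c _ ↦ l * c) ?_ ?_ ?_ ?_
      · intro c hc
        have hce := Nat.dvd_of_mem_divisors hc
        simp only [mem_filter, Nat.mem_divisors]
        exact ⟨⟨(Nat.mul_dvd_mul_left l hce).trans ht, hP.ne_zero⟩, Nat.dvd_mul_right l c,
          Nat.mul_dvd_mul_left l hce⟩
      · intro a _ b _ hab
        exact Nat.eq_of_mul_eq_mul_left (Nat.pos_of_ne_zero hl0) hab
      · intro d hd
        simp only [mem_filter, Nat.mem_divisors] at hd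
        obtain ⟨-, ⟨c, rfl⟩, h⟩ := hd
        exact ⟨c, Nat.mem_divisors.2 ⟨Nat.dvd_of_mul_dvd_mul_left (Nat.pos_of_ne_zero hl0) h, he0⟩,
          rfl⟩
      · intro c hc
        have := hcop.coprime_dvd_right (Nat.dvd_of_mem_divisors hc)
        rw [isMultiplicative_moebius.map_mul_of_coprime this]
        push_cast
        ring
    rw [key, ← mul_sum]
    have h1 : (∑ c ∈ e.divisors, (μ c : ℝ)) = if e = 1 then 1 else 0 := by
      rw [← Int.cast_sum, ← coe_mul_zeta_apply, moebius_mul_coe_zeta, one_apply]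
      split_ifs <;> simp
    rw [h1]
    have : l * e = l ↔ e = 1 := by
      constructor
      · intro h
        exact Nat.eq_of_mul_eq_mul_left (Nat.pos_of_ne_zero hl0) (by simpa using h)
      · rintro rfl; simp
    simp [this]
  · have hne : t ≠ l := by rintro rfl; exact hlt dvd_rfl
    rw [if_neg hne]
    refine sum_eq_zero fun d _ ↦ if_neg ?_
    rintro ⟨h1, h2⟩
    exact hlt (h1.trans h2)

variable (s : BoundingSieve) (z : ℕ)

/-- The sum of the Selberg terms over the divisors of the sifting product that are at most `z`. -/
noncomputable def selbergSum : ℝ := ∑ l ∈ s.prodPrimes.divisors with l ≤ z, s.selbergTerms l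

/-- The optimal weights of the Selberg sieve, truncated at `z`. -/
noncomputable def selbergWeights (d : ℕ) : ℝ :=
  (s.nu d)⁻¹ * μ d *
    ((∑ l ∈ s.prodPrimes.divisors with l ≤ z, if d ∣ l then s.selbergTerms l else 0) /
      s.selbergSum z)

variable {s z}

lemma selbergSum_pos (hz : 1 ≤ z) : 0 < s.selbergSum z := by
  refine sum_pos (fun l hl ↦ ?_) ⟨1, ?_⟩
  · exact selbergTerms_pos (Nat.dvd_of_mem_divisors (mem_filter.1 hl).1)
  · simp [hz, prodPrimes_ne_zero]

lemma selbergWeights_one (hz : 1 ≤ z) : s.selbergWeights z 1 = 1 := by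
  have h := (selbergSum_pos (s := s) hz).ne'
  have : (∑ l ∈ s.prodPrimes.divisors with l ≤ z, if 1 ∣ l then s.selbergTerms l else 0)
      = s.selbergSum z := by simp [selbergSum]
  rw [selbergWeights, this, div_self h, s.nu_mult.map_one]
  simp

lemma selbergWeights_eq_zero {d : ℕ} (hd : z < d) : s.selbergWeights z d = 0 := by
  rw [selbergWeights, sum_eq_zero, zero_div, mul_zero]
  intro l hl
  simp only [mem_filter, Nat.mem_divisors] at hl
  refine if_neg fun hdl ↦ ?_
  have := Nat.le_of_dvd (Nat.pos_of_ne_zero (ne_zero_of_dvd_ne_zero hl.1.2 hl.1.1)) hdl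
  lia

lemma abs_selbergWeights_le (hz : 1 ≤ z) {d : ℕ} (hd : d ∣ s.prodPrimes) :
    |s.selbergWeights z d| ≤ (s.nu d)⁻¹ := by
  have hG := selbergSum_pos (s := s) hz
  have hν := nu_pos_of_dvd_prodPrimes hd
  have hpos : ∀ l ∈ s.prodPrimes.divisors.filter (· ≤ z), 0 ≤ s.selbergTerms l := fun l hl ↦
    (selbergTerms_pos (Nat.dvd_of_mem_divisors (mem_filter.1 hl).1)).le
  have h0 : 0 ≤ ∑ l ∈ s.prodPrimes.divisors with l ≤ z,
      if d ∣ l then s.selbergTerms l else 0 :=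
    sum_nonneg fun l hl ↦ by split_ifs; exacts [hpos l hl, le_rfl]
  have h1 : (∑ l ∈ s.prodPrimes.divisors with l ≤ z,
      if d ∣ l then s.selbergTerms l else 0) ≤ s.selbergSum z :=
    sum_le_sum fun l hl ↦ by split_ifs; exacts [le_rfl, hpos l hl]
  have hμ : |(μ d : ℝ)| ≤ 1 := by
    exact_mod_cast abs_moebius_le_one
  rw [selbergWeights, abs_mul, abs_mul, abs_of_nonneg (inv_nonneg.2 hν.le),
    abs_of_nonneg (div_nonneg h0 hG.le), mul_assoc]
  refine mul_le_of_le_one_right (inv_nonneg.2 hν.le) ?_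
  exact mul_le_one₀ hμ (div_nonneg h0 hG.le) ((div_le_one hG).2 h1)

lemma sum_nu_mul_selbergWeights {l : ℕ} :
    (∑ d ∈ s.prodPrimes.divisors, if l ∣ d then s.nu d * s.selbergWeights z d else 0) =
      if l ∈ s.prodPrimes.divisors.filter (· ≤ z) then
        μ l * s.selbergTerms l / s.selbergSum z else 0 := by
  have h1 : ∀ d ∈ s.prodPrimes.divisors,
      (if l ∣ d then s.nu d * s.selbergWeights z d else 0) =
        ∑ t ∈ s.prodPrimes.divisors with t ≤ z, s.selbergTerms t / s.selbergSum z *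
          if l ∣ d ∧ d ∣ t then (μ d : ℝ) else 0 := by
    intro d hd
    have hν := nu_ne_zero (Nat.dvd_of_mem_divisors hd)
    split_ifs with hld
    · rw [selbergWeights, ← mul_assoc, ← mul_assoc, mul_inv_cancel₀ hν, one_mul, sum_div, mul_sum]
      refine sum_congr rfl fun t _ ↦ ?_
      by_cases hdt : d ∣ t <;> simp [hld, hdt, mul_comm]
    · simp [hld]
  rw [sum_congr rfl h1, sum_comm]
  have h2 : ∀ t ∈ s.prodPrimes.divisors.filter (· ≤ z),
      (∑ d ∈ s.prodPrimes.divisors, s.selbergTerms t / s.selbergSum z *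
          if l ∣ d ∧ d ∣ t then (μ d : ℝ) else 0) =
        if t = l then μ l * s.selbergTerms l / s.selbergSum z else 0 := by
    intro t ht
    rw [← mul_sum, sum_moebius_between s.prodPrimes_squarefree
      (Nat.dvd_of_mem_divisors (mem_filter.1 ht).1)]
    split_ifs with h
    · subst h; ring
    · simp
  rw [sum_congr rfl h2, sum_ite_eq']

lemma mainSum_lambdaSquared_selbergWeights (hz : 1 ≤ z) :
    s.mainSum (lambdaSquared (s.selbergWeights z)) = (s.selbergSum z)⁻¹ := by
  have hG := (selbergSum_pos (s := s) hz).ne'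
  rw [mainSum_lambdaSquared_eq_sum_mul_sum_sq]
  have h1 : ∀ l ∈ s.prodPrimes.divisors, (s.selbergTerms l)⁻¹ *
      (∑ d ∈ s.prodPrimes.divisors,
        if l ∣ d then s.nu d * s.selbergWeights z d else 0) ^ 2 =
      if l ≤ z then s.selbergTerms l / s.selbergSum z ^ 2 else 0 := by
    intro l hl
    have hg := (selbergTerms_pos (Nat.dvd_of_mem_divisors hl)).ne'
    have hμ : (μ l : ℝ) ^ 2 = 1 := by
      exact_mod_cast moebius_sq_eq_one_of_squarefree (squarefree_of_mem_divisors_prodPrimes hl)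
    rw [sum_nu_mul_selbergWeights]
    by_cases hlz : l ≤ z
    · rw [if_pos (mem_filter.2 ⟨hl, hlz⟩), if_pos hlz, div_pow, mul_pow, hμ]
      field_simp
    · rw [if_neg (fun h : l ∈ _ ↦ hlz (mem_filter.1 h).2), if_neg hlz]
      simp
  rw [sum_congr rfl h1, ← sum_filter, ← sum_div]
  change s.selbergSum z / _ = _
  field_simp

lemma abs_lambdaSquared_le {w : ℕ → ℝ} {B : ℝ} (hB : 0 ≤ B) {d : ℕ}
    (hw : ∀ e, e ∣ d → |w e| ≤ B) (hw0 : ∀ e, z < e → w e = 0) :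
    |lambdaSquared w d| ≤ (z * B) ^ 2 := by
  have hsum : (∑ e ∈ d.divisors, |w e|) ≤ z * B := by
    calc (∑ e ∈ d.divisors, |w e|) = ∑ e ∈ d.divisors with e ≤ z, |w e| := by
          rw [sum_filter]
          refine sum_congr rfl fun e _ ↦ ?_
          split_ifs with h
          · rfl
          · rw [hw0 e (by lia), abs_zero]
      _ ≤ ∑ e ∈ d.divisors with e ≤ z, B :=
          sum_le_sum fun e he ↦ hw e (Nat.dvd_of_mem_divisors (mem_filter.1 he).1)
      _ ≤ ∑ e ∈ Icc 1 z, B := by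
          refine sum_le_sum_of_subset_of_nonneg (fun e he ↦ ?_) (fun _ _ _ ↦ hB)
          simp only [mem_filter] at he
          exact mem_Icc.2 ⟨Nat.pos_of_mem_divisors he.1, he.2⟩
      _ = z * B := by simp
  calc |lambdaSquared w d| ≤ ∑ d1 ∈ d.divisors, ∑ d2 ∈ d.divisors, |w d1| * |w d2| := by
        refine (abs_sum_le_sum_abs _ _).trans (sum_le_sum fun d1 _ ↦ ?_)
        refine (abs_sum_le_sum_abs _ _).trans (sum_le_sum fun d2 _ ↦ ?_)
        split_ifs
        · rw [abs_mul]
        · rw [abs_zero]; positivity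
    _ = (∑ e ∈ d.divisors, |w e|) ^ 2 := by rw [sq, sum_mul_sum]
    _ ≤ (z * B) ^ 2 := by gcongr

lemma lambdaSquared_eq_zero {w : ℕ → ℝ} (hw0 : ∀ e, z < e → w e = 0) {d : ℕ} (hd : z ^ 2 < d) :
    lambdaSquared w d = 0 := by
  refine sum_eq_zero fun d1 h1 ↦ sum_eq_zero fun d2 h2 ↦ ?_
  split_ifs with h
  · by_cases hd1 : z < d1
    · simp [hw0 d1 hd1]
    by_cases hd2 : z < d2
    · simp [hw0 d2 hd2]
    exfalso
    have h3 : d1.lcm d2 ≤ d1 * d2 := Nat.le_of_dvd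
      (Nat.mul_pos (Nat.pos_of_mem_divisors h1) (Nat.pos_of_mem_divisors h2))
      (Nat.lcm_dvd_mul d1 d2)
    have : d1 * d2 ≤ z * z := Nat.mul_le_mul (by lia) (by lia)
    nlinarith
  · rfl

/-- The Selberg upper bound sieve, with a crude error term. -/
theorem siftedSum_le_div_selbergSum_add (hz : 1 ≤ z)
    (hν : ∀ d, d ∣ s.prodPrimes → (s.nu d)⁻¹ ≤ d) (hrem : ∀ d, d ∣ s.prodPrimes → |s.rem d| ≤ d) :
    s.siftedSum ≤ s.totalMass / s.selbergSum z + (z : ℝ) ^ 8 := by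
  set w := s.selbergWeights z
  have hw0 : ∀ e, z < e → w e = 0 := fun e he ↦ selbergWeights_eq_zero he
  have hw : ∀ e, e ∣ s.prodPrimes → |w e| ≤ z := by
    intro e he
    by_cases hez : z < e
    · rw [hw0 e hez, abs_zero]; positivity
    · refine (abs_selbergWeights_le hz he).trans ((hν e he).trans ?_)
      exact_mod_cast not_lt.1 hez
  have herr : s.errSum (lambdaSquared w) ≤ (z : ℝ) ^ 8 := by
    calc s.errSum (lambdaSquared w)
        = ∑ d ∈ s.prodPrimes.divisors with d ≤ z ^ 2, |lambdaSquared w d| * |s.rem d| := by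
          rw [errSum, sum_filter]
          refine sum_congr rfl fun d _ ↦ ?_
          split_ifs with h
          · rfl
          · rw [lambdaSquared_eq_zero hw0 (not_le.1 h), abs_zero, zero_mul]
      _ ≤ ∑ d ∈ s.prodPrimes.divisors with d ≤ z ^ 2, ((z : ℝ) * z) ^ 2 * (z : ℝ) ^ 2 := by
          refine sum_le_sum fun d hd ↦ ?_
          simp only [mem_filter, Nat.mem_divisors] at hd
          gcongr
          · exact abs_lambdaSquared_le (by positivity) (fun e he ↦ hw e (he.trans hd.1.1)) hw0
          · refine (hrem d hd.1.1).trans ?_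
            exact_mod_cast hd.2
      _ ≤ ∑ d ∈ Icc 1 (z ^ 2), ((z : ℝ) * z) ^ 2 * (z : ℝ) ^ 2 := by
          refine sum_le_sum_of_subset_of_nonneg (fun e he ↦ ?_) (fun _ _ _ ↦ by positivity)
          simp only [mem_filter] at he
          exact mem_Icc.2 ⟨Nat.pos_of_mem_divisors he.1, he.2⟩
      _ = (z : ℝ) ^ 8 := by simp; ring
  have := s.siftedSum_le_mainSum_errSum_of_upperMoebius _
    (upperMoebius_lambdaSquared w (selbergWeights_one hz))
  rw [mainSum_lambdaSquared_selbergWeights hz, ← div_eq_mul_inv] at this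
  linarith

end BoundingSieve

section TruncatedEulerProduct

open Finset

/-- The sum of `F` over the positive integers up to `u` whose prime factors lie in `S`. -/
noncomputable def factoredSum (F : ℕ → ℝ) (S : Finset ℕ) (u : ℕ) : ℝ :=
  ∑ n ∈ Icc 1 u with n.primeFactors ⊆ S, F n

/-- The sum of `∏ p ∈ D, a p` over the subsets `D` of `S` whose product is at most `u`. -/
noncomputable def powersetProdSum (a : ℕ → ℝ) (S : Finset ℕ) (u : ℕ) : ℝ :=
  ∑ D ∈ S.powerset with ∏ p ∈ D, p ≤ u, ∏ p ∈ D, a p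

variable {F a c B : ℕ → ℝ} {S : Finset ℕ} {p u v : ℕ}

lemma powersetProdSum_insert (hp : 0 < p) (hpS : p ∉ S) :
    powersetProdSum a (insert p S) u = powersetProdSum a S u + a p * powersetProdSum a S (u / p) := by
  simp only [powersetProdSum, sum_filter]
  rw [sum_powerset_insert hpS, mul_sum]
  congr 1
  refine sum_congr rfl fun D hD ↦ ?_
  have hpD : p ∉ D := fun h ↦ hpS (mem_powerset.1 hD h)
  rw [prod_insert hpD, prod_insert hpD, mul_ite, mul_zero, mul_comm p]
  simp only [Nat.le_div_iff_mul_le hp]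

lemma powersetProdSum_mono (ha : ∀ q ∈ S, 0 ≤ a q) (huv : u ≤ v) :
    powersetProdSum a S u ≤ powersetProdSum a S v := by
  refine sum_le_sum_of_subset_of_nonneg ?_ ?_
  · exact monotone_filter_right _ fun D _ h ↦ h.trans huv
  · intro D hD _
    exact prod_nonneg fun q hq ↦ ha q (mem_powerset.1 (mem_filter.1 hD).1 hq)

lemma powersetProdSum_nonneg (ha : ∀ q ∈ S, 0 ≤ a q) : 0 ≤ powersetProdSum a S u :=
  sum_nonneg fun _ hD ↦ prod_nonneg fun q hq ↦ ha q (mem_powerset.1 (mem_filter.1 hD).1 hq)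

lemma factoredSum_insert_le (hF : ∀ n, 0 ≤ F n)
    (hFmul : ∀ m n, m.Coprime n → F (m * n) = F m * F n) (hp : p.Prime) (hpS : p ∉ S) :
    factoredSum F (insert p S) u ≤
      ∑ j ∈ range (u + 1), F (p ^ j) * factoredSum F S (u / p ^ j) := by
  have hmaps : ∀ n ∈ (Icc 1 u).filter (fun n ↦ n.primeFactors ⊆ insert p S),
      n.factorization p ∈ range (u + 1) := by
    intro n hn
    simp only [mem_filter, mem_Icc] at hn
    have := Nat.factorization_lt (n := n) p (by lia)
    simp only [mem_range]
    lia
  rw [factoredSum, ← sum_fiberwise_of_maps_to hmaps]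
  refine sum_le_sum fun j _ ↦ ?_
  rw [factoredSum, mul_sum]
  have hpj : 0 < p ^ j := pow_pos hp.pos j
  have hsplit : ∀ n ∈ ((Icc 1 u).filter (fun n ↦ n.primeFactors ⊆ insert p S)).filter
      (fun n ↦ n.factorization p = j), p ^ j * (n / p ^ j) = n ∧
        F (p ^ j) * F (n / p ^ j) = F n ∧
        n / p ^ j ∈ (Icc 1 (u / p ^ j)).filter (fun n ↦ n.primeFactors ⊆ S) := by
    intro n hn
    simp only [mem_filter, mem_Icc] at hn
    obtain ⟨⟨⟨h1, hu⟩, hS⟩, rfl⟩ := hn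
    have hn0 : n ≠ 0 := by lia
    have hmul := Nat.ordProj_mul_ordCompl_eq_self n p
    have hndvd := Nat.not_dvd_ordCompl hp hn0
    have hcop : (p ^ n.factorization p).Coprime (n / p ^ n.factorization p) :=
      Nat.Coprime.pow_left _ ((Nat.Prime.coprime_iff_not_dvd hp).2 hndvd)
    have hpos := Nat.ordCompl_pos p hn0
    refine ⟨hmul, ?_, ?_⟩
    · rw [← hFmul _ _ hcop, hmul]
    · simp only [mem_filter, mem_Icc]
      refine ⟨⟨hpos, Nat.div_le_div_right hu⟩, fun q hq ↦ ?_⟩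
      have hq' := Nat.mem_primeFactors.1 hq
      have hqn : q ∈ n.primeFactors :=
        Nat.mem_primeFactors.2 ⟨hq'.1, hq'.2.1.trans (Nat.ordCompl_dvd n p), hn0⟩
      rcases mem_insert.1 (hS hqn) with rfl | h
      · exact absurd hq'.2.1 hndvd
      · exact h
  rw [← sum_congr rfl fun n hn ↦ (hsplit n hn).2.1]
  have hinj : Set.InjOn (fun n ↦ n / p ^ j)
      (((Icc 1 u).filter (fun n ↦ n.primeFactors ⊆ insert p S)).filter
        (fun n ↦ n.factorization p = j)) := by
    intro m hm n hn hmn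
    simp only at hmn
    rw [← (hsplit m hm).1, ← (hsplit n hn).1, hmn]
  rw [← sum_image (f := fun n ↦ F (p ^ j) * F n) hinj]
  refine sum_le_sum_of_subset_of_nonneg ?_ fun _ _ _ ↦ mul_nonneg (hF _) (hF _)
  exact image_subset_iff.2 fun n hn ↦ (hsplit n hn).2.2

/-- A truncated Euler product comparison: if `1 + B p ≤ c p * (1 + a p)`, where `B p` bounds the
contribution of the prime powers `p ^ j` with `j ≥ 1` to `F`, then the truncated sum of `F` is at
most `∏ c p` times the truncated sum of `a`. -/
theorem factoredSum_le_prod_mul_powersetProdSum (hF : ∀ n, 0 ≤ F n) (hF1 : F 1 = 1)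
    (hFmul : ∀ m n, m.Coprime n → F (m * n) = F m * F n) (hS : ∀ p ∈ S, p.Prime)
    (ha : ∀ p ∈ S, 0 ≤ a p) (hc : ∀ p ∈ S, 1 ≤ c p)
    (hB : ∀ p ∈ S, ∀ K, ∑ j ∈ range K, F (p ^ (j + 1)) ≤ B p)
    (habc : ∀ p ∈ S, 1 + B p ≤ c p * (1 + a p)) (u : ℕ) :
    factoredSum F S u ≤ (∏ p ∈ S, c p) * powersetProdSum a S u := by
  induction S using Finset.induction_on generalizing u with
  | empty =>
    rcases Nat.eq_zero_or_pos u with rfl | hu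
    · simpa [factoredSum] using
        powersetProdSum_nonneg (a := a) (S := ∅) (u := 0) (by simp)
    · have h1 : (Icc 1 u).filter (fun n ↦ n.primeFactors ⊆ ∅) = {1} := by
        ext n
        simp only [subset_empty, Nat.primeFactors_eq_empty, mem_filter, mem_Icc, mem_singleton]
        lia
      have h2 : (∅ : Finset ℕ).powerset.filter (fun D ↦ ∏ p ∈ D, p ≤ u) = {∅} := by
        ext D
        simp only [powerset_empty, mem_filter, mem_singleton]
        constructor
        · exact fun h ↦ h.1
        · rintro rfl; simpa using hu.nat_succ_le
      simp only [factoredSum, powersetProdSum]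
      rw [h1, h2]
      simp [hF1]
  | insert p S hpS ih =>
    have hp := hS p (mem_insert_self p S)
    have ih' := ih (fun q hq ↦ hS q (mem_insert_of_mem hq))
      (fun q hq ↦ ha q (mem_insert_of_mem hq)) (fun q hq ↦ hc q (mem_insert_of_mem hq))
      (fun q hq ↦ hB q (mem_insert_of_mem hq)) (fun q hq ↦ habc q (mem_insert_of_mem hq))
    have haS : ∀ q ∈ S, 0 ≤ a q := fun q hq ↦ ha q (mem_insert_of_mem hq)
    have hC : 0 ≤ ∏ q ∈ S, c q :=
      prod_nonneg fun q hq ↦ zero_le_one.trans (hc q (mem_insert_of_mem hq))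
    have hH := powersetProdSum_nonneg (u := u / p) haS
    have hHH : powersetProdSum a S (u / p) ≤ powersetProdSum a S u := powersetProdSum_mono haS (Nat.div_le_self u p)
    have hc1 := hc p (mem_insert_self p S)
    have hB1 := hB p (mem_insert_self p S) u
    have hk := habc p (mem_insert_self p S)
    have hterm : ∀ j ∈ range u, F (p ^ (j + 1)) * factoredSum F S (u / p ^ (j + 1)) ≤
        F (p ^ (j + 1)) * ((∏ q ∈ S, c q) * powersetProdSum a S (u / p)) := by
      intro j _
      refine mul_le_mul_of_nonneg_left ((ih' _).trans ?_) (hF _)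
      refine mul_le_mul_of_nonneg_left (powersetProdSum_mono haS ?_) hC
      exact Nat.div_le_div_left (Nat.le_self_pow (by lia) p) hp.pos
    calc factoredSum F (insert p S) u
        ≤ ∑ j ∈ range (u + 1), F (p ^ j) * factoredSum F S (u / p ^ j) :=
          factoredSum_insert_le hF hFmul hp hpS
      _ = ∑ j ∈ range u, F (p ^ (j + 1)) * factoredSum F S (u / p ^ (j + 1)) +
            factoredSum F S u := by
          rw [sum_range_succ']; simp [hF1]
      _ ≤ ∑ j ∈ range u, F (p ^ (j + 1)) * ((∏ q ∈ S, c q) * powersetProdSum a S (u / p)) +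
            (∏ q ∈ S, c q) * powersetProdSum a S u := add_le_add (sum_le_sum hterm) (ih' u)
      _ ≤ B p * ((∏ q ∈ S, c q) * powersetProdSum a S (u / p)) +
            (∏ q ∈ S, c q) * powersetProdSum a S u := by
          rw [← sum_mul]
          gcongr
      _ = (∏ q ∈ S, c q) * (powersetProdSum a S u + B p * powersetProdSum a S (u / p)) := by ring
      _ ≤ (∏ q ∈ S, c q) * (c p * (powersetProdSum a S u + a p * powersetProdSum a S (u / p))) := by
          refine mul_le_mul_of_nonneg_left ?_ hC
          nlinarith [mul_le_mul_of_nonneg_right hk hH,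
            mul_le_mul_of_nonneg_left hHH (sub_nonneg.2 hc1)]
      _ = (∏ q ∈ insert p S, c q) * powersetProdSum a (insert p S) u := by
          rw [prod_insert hpS, powersetProdSum_insert hp.pos hpS]
          ring

lemma sum_range_succ_mul_geometric_le {r : ℝ} (hr0 : 0 ≤ r) (hr1 : r < 1) (K : ℕ) :
    ∑ j ∈ range K, ((j : ℝ) + 2) * r ^ (j + 1) ≤ ((1 - r) ^ 2)⁻¹ - 1 := by
  have h := hasSum_choose_mul_geometric_of_norm_lt_one 1
    (show ‖r‖ < 1 by rwa [Real.norm_of_nonneg hr0])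
  have h2 := sum_le_hasSum (range (K + 1)) (fun i _ ↦ by positivity) h
  rw [sum_range_succ'] at h2
  simp only [Nat.choose_one_right] at h2
  push_cast at h2
  have h3 : ∑ j ∈ range K, ((j : ℝ) + 2) * r ^ (j + 1) =
      ∑ j ∈ range K, ((j : ℝ) + 1 + 1) * r ^ (j + 1) :=
    sum_congr rfl fun j _ ↦ by ring
  rw [h3]
  norm_num at h2 ⊢
  linarith

/-- A lower bound for the truncated sum of `∏ a p`, obtained by comparison with `∑ τ(n) / n`. -/
theorem sq_log_le_prod_mul_powersetProdSum {y : ℕ}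
    (ha : ∀ p ∈ Nat.primesLE (y ^ 2), 0 ≤ a p)
    (hc : ∀ p ∈ Nat.primesLE (y ^ 2), 1 ≤ c p)
    (hac : ∀ p ∈ Nat.primesLE (y ^ 2), ((1 - 1 / (p : ℝ)) ^ 2)⁻¹ ≤ c p * (1 + a p)) :
    Real.log (y + 1) ^ 2 ≤
      (∏ p ∈ Nat.primesLE (y ^ 2), c p) * powersetProdSum a (Nat.primesLE (y ^ 2)) (y ^ 2) := by
  set F : ℕ → ℝ := fun n ↦ (n.divisors.card : ℝ) / n with hF
  have hprime : ∀ p ∈ Nat.primesLE (y ^ 2), p.Prime := fun p hp ↦ (Nat.mem_primesLE.1 hp).2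
  have key := factoredSum_le_prod_mul_powersetProdSum (F := F) (a := a) (c := c)
    (B := fun p ↦ ((1 - 1 / (p : ℝ)) ^ 2)⁻¹ - 1) (S := Nat.primesLE (y ^ 2))
    (fun n ↦ by positivity) (by simp [hF])
    (fun m n h ↦ by
      simp only [hF, h.card_divisors_mul]
      push_cast
      rw [mul_div_mul_comm]) hprime ha hc ?_ (fun p hp ↦ by simpa using hac p hp) (y ^ 2)
  · refine le_trans ?_ key
    have hlog : Real.log (y + 1) ≤ ∑ i ∈ Icc 1 y, (1 : ℝ) / i := by
      have := log_add_one_le_harmonic y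
      rw [harmonic_eq_sum_Icc] at this
      push_cast at this
      simpa using this
    have hlog0 : 0 ≤ Real.log (y + 1) := Real.log_nonneg (by linarith [Nat.cast_nonneg (α := ℝ) y])
    have hall : factoredSum F (Nat.primesLE (y ^ 2)) (y ^ 2) = ∑ n ∈ Icc 1 (y ^ 2), F n := by
      rw [factoredSum, filter_true_of_mem]
      intro n hn q hq
      have hn' := mem_Icc.1 hn
      exact Nat.mem_primesLE.2 ⟨(Nat.le_of_mem_primeFactors hq).trans hn'.2,
        Nat.prime_of_mem_primeFactors hq⟩
    rw [hall]
    calc Real.log (y + 1) ^ 2 ≤ (∑ i ∈ Icc 1 y, (1 : ℝ) / i) ^ 2 := by gcongr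
      _ = ∑ x ∈ Icc 1 y ×ˢ Icc 1 y, (1 : ℝ) / ((x.1 * x.2 : ℕ) : ℝ) := by
        rw [sq, sum_mul_sum, sum_product]
        refine sum_congr rfl fun i _ ↦ sum_congr rfl fun j _ ↦ ?_
        push_cast
        rw [div_mul_div_comm, one_mul]
      _ = ∑ n ∈ Icc 1 (y ^ 2), ∑ x ∈ Icc 1 y ×ˢ Icc 1 y with x.1 * x.2 = n,
            (1 : ℝ) / ((x.1 * x.2 : ℕ) : ℝ) := by
        refine (sum_fiberwise_of_maps_to (g := fun x : ℕ × ℕ ↦ x.1 * x.2) ?_ _).symm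
        intro x hx
        simp only [mem_product, mem_Icc] at hx ⊢
        refine ⟨Nat.mul_pos hx.1.1 hx.2.1, ?_⟩
        rw [sq]
        exact Nat.mul_le_mul hx.1.2 hx.2.2
      _ ≤ ∑ n ∈ Icc 1 (y ^ 2), F n := by
        refine sum_le_sum fun n hn ↦ ?_
        have hn0 : n ≠ 0 := by have := mem_Icc.1 hn; lia
        calc ∑ x ∈ Icc 1 y ×ˢ Icc 1 y with x.1 * x.2 = n, (1 : ℝ) / ((x.1 * x.2 : ℕ) : ℝ)
            = ∑ x ∈ Icc 1 y ×ˢ Icc 1 y with x.1 * x.2 = n, (1 : ℝ) / n :=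
              sum_congr rfl fun x hx ↦ by rw [(mem_filter.1 hx).2]
          _ ≤ ∑ x ∈ n.divisorsAntidiagonal, (1 : ℝ) / n := by
              refine sum_le_sum_of_subset_of_nonneg (fun x hx ↦ ?_) fun _ _ _ ↦ by positivity
              exact Nat.mem_divisorsAntidiagonal.2 ⟨(mem_filter.1 hx).2, hn0⟩
          _ = F n := by
              rw [sum_const, nsmul_eq_mul, mul_one_div, ← Nat.map_div_right_divisors, card_map]
  · intro p hp K
    have hpp := hprime p hp
    have hp1 : (1 : ℝ) < p := by exact_mod_cast hpp.one_lt
    have := sum_range_succ_mul_geometric_le (r := 1 / (p : ℝ)) (by positivity)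
      ((div_lt_one (by linarith)).2 hp1) K
    refine le_trans (le_of_eq (sum_congr rfl fun j _ ↦ ?_)) this
    simp only [hF, Nat.divisors_prime_pow hpp, card_map, card_range]
    push_cast
    rw [one_div, inv_pow]
    ring

end TruncatedEulerProduct

section CountingSieve

open Finset ArithmeticFunction

/-- The sieve problem for the values of `f` on `{0, …, N - 1}`, with density `∏ p ∣ d, g p`. -/
noncomputable def countingSieve (N : ℕ) (f : ℕ → ℕ) {P : ℕ} (hP : Squarefree P) {g : ℕ → ℝ}
    (hg0 : ∀ p, p.Prime → p ∣ P → 0 < g p) (hg1 : ∀ p, p.Prime → p ∣ P → g p < 1) :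
    BoundingSieve where
  support := (range N).image f
  prodPrimes := P
  prodPrimes_squarefree := hP
  weights v := #{n ∈ range N | f n = v}
  weights_nonneg _ := Nat.cast_nonneg _
  totalMass := N
  nu := prodPrimeFactors g
  nu_mult := IsMultiplicative.prodPrimeFactors g
  nu_pos_of_prime p hp hpP := by
    simpa [prodPrimeFactors_apply hp.ne_zero, hp.primeFactors] using hg0 p hp hpP
  nu_lt_one_of_prime p hp hpP := by
    simpa [prodPrimeFactors_apply hp.ne_zero, hp.primeFactors] using hg1 p hp hpP

lemma sum_image_card_fiber (A : Finset ℕ) (f : ℕ → ℕ) (Q : ℕ → Prop) [DecidablePred Q] :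
    (∑ v ∈ A.image f, if Q v then (#{n ∈ A | f n = v} : ℝ) else 0) = #{n ∈ A | Q (f n)} := by
  rw [← sum_filter, card_eq_sum_card_fiberwise (f := f) (t := (A.image f).filter Q)]
  · push_cast
    refine sum_congr rfl fun v hv ↦ ?_
    congr 2
    ext n
    simp only [mem_filter] at hv ⊢
    constructor
    · rintro ⟨h1, rfl⟩
      exact ⟨⟨h1, hv.2⟩, rfl⟩
    · rintro ⟨⟨h1, -⟩, h2⟩
      exact ⟨h1, h2⟩
  · intro n hn
    simp only [coe_filter, Set.mem_ofPred_eq] at hn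
    simp only [coe_filter, Set.mem_ofPred_eq]
    exact ⟨mem_image_of_mem f hn.1, hn.2⟩

variable {N : ℕ} {f : ℕ → ℕ} {P : ℕ} {hP : Squarefree P} {g : ℕ → ℝ}
  {hg0 : ∀ p, p.Prime → p ∣ P → 0 < g p} {hg1 : ∀ p, p.Prime → p ∣ P → g p < 1}

lemma countingSieve_multSum (d : ℕ) :
    (countingSieve N f hP hg0 hg1).multSum d = #{n ∈ range N | d ∣ f n} :=
  sum_image_card_fiber _ _ _

lemma countingSieve_siftedSum :
    (countingSieve N f hP hg0 hg1).siftedSum = #{n ∈ range N | P.Coprime (f n)} :=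
  sum_image_card_fiber _ _ _

lemma powersetProdSum_le_selbergSum (s : BoundingSieve) {a : ℕ → ℝ} {S : Finset ℕ} (z : ℕ)
    (hS : ∀ p ∈ S, p.Prime) (ha : ∀ p ∈ S, p ∣ s.prodPrimes → a p = s.nu p * (1 - s.nu p)⁻¹)
    (ha0 : ∀ p ∈ S, ¬ p ∣ s.prodPrimes → a p = 0) :
    powersetProdSum a S z ≤ s.selbergSum z := by
  set 𝒟 := (S.powerset.filter fun D ↦ ∏ p ∈ D, p ≤ z).filter fun D ↦ ∀ p ∈ D, p ∣ s.prodPrimes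
  have hmem : ∀ D ∈ 𝒟, D ⊆ S ∧ ∏ p ∈ D, p ≤ z ∧ (∀ p ∈ D, p ∣ s.prodPrimes) ∧
      (∀ p ∈ D, p.Prime) ∧ (∏ p ∈ D, p).primeFactors = D ∧ ∏ p ∈ D, p ∣ s.prodPrimes := by
    intro D hD
    simp only [𝒟, mem_filter, mem_powerset] at hD
    have hpr : ∀ p ∈ D, p.Prime := fun p hp ↦ hS p (hD.1.1 hp)
    exact ⟨hD.1.1, hD.1.2, hD.2, hpr, Nat.primeFactors_prod hpr,
      prod_primes_dvd _ (fun p hp ↦ (hpr p hp).prime) hD.2⟩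
  have h1 : powersetProdSum a S z = ∑ D ∈ 𝒟, ∏ p ∈ D, a p := by
    rw [powersetProdSum]
    symm
    refine sum_filter_of_ne fun D hD hne p hp ↦ ?_
    by_contra hpP
    exact hne (prod_eq_zero hp
      (ha0 p (mem_powerset.1 (mem_filter.1 hD).1 hp) hpP))
  have h2 : ∀ D ∈ 𝒟, ∏ p ∈ D, a p = s.selbergTerms (∏ p ∈ D, p) := by
    intro D hD
    obtain ⟨hDS, -, hdvd, -, hpf, hDP⟩ := hmem D hD
    rw [BoundingSieve.selbergTerms_apply, ← BoundingSieve.prod_primeFactors_nu hDP, hpf,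
      ← prod_mul_distrib]
    exact prod_congr rfl fun p hp ↦ ha p (hDS hp) (hdvd p hp)
  have hinj : Set.InjOn (fun D : Finset ℕ ↦ ∏ p ∈ D, p) 𝒟 := by
    intro D hD E hE hDE
    simp only at hDE
    rw [← (hmem D hD).2.2.2.2.1, hDE, (hmem E hE).2.2.2.2.1]
  rw [h1, sum_congr rfl h2, ← sum_image (f := fun n ↦ s.selbergTerms n) hinj]
  refine sum_le_sum_of_subset_of_nonneg ?_ fun l hl _ ↦
    (BoundingSieve.selbergTerms_pos (Nat.dvd_of_mem_divisors (mem_filter.1 hl).1)).le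
  refine image_subset_iff.2 fun D hD ↦ ?_
  obtain ⟨-, hz, -, -, -, hDP⟩ := hmem D hD
  exact mem_filter.2 ⟨Nat.mem_divisors.2 ⟨hDP, BoundingSieve.prodPrimes_ne_zero⟩, hz⟩

lemma abs_card_filter_zmod_sub_le (N d : ℕ) [NeZero d] (Q : ZMod d → Prop) [DecidablePred Q] :
    |(#{n ∈ range N | Q ((n : ℕ) : ZMod d)} : ℝ) - (#{t : ZMod d | Q t} : ℝ) / d * N| ≤ d := by
  have hd : (0 : ℝ) < d := by exact_mod_cast Nat.pos_of_ne_zero (NeZero.ne d)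
  have h1 : #{n ∈ range N | Q ((n : ℕ) : ZMod d)} =
      ∑ t : ZMod d with Q t, #{n ∈ range N | ((n : ℕ) : ZMod d) = t} := by
    rw [card_eq_sum_card_fiberwise (f := fun n : ℕ ↦ (n : ZMod d))
      (t := univ.filter Q)]
    · refine sum_congr rfl fun t ht ↦ ?_
      congr 1
      ext n
      simp only [mem_filter, mem_univ, true_and] at ht ⊢
      constructor
      · rintro ⟨⟨h1, -⟩, h2⟩
        exact ⟨h1, h2⟩
      · rintro ⟨h1, rfl⟩
        exact ⟨⟨h1, ht⟩, rfl⟩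
    · intro n hn
      simpa using (mem_filter.1 hn).2
  have h2 : ∀ t : ZMod d, |(#{n ∈ range N | ((n : ℕ) : ZMod d) = t} : ℝ) - (N : ℝ) / d| ≤ 1 := by
    intro t
    have hc : #{n ∈ range N | ((n : ℕ) : ZMod d) = t} = N.count (· ≡ t.val [MOD d]) := by
      rw [Nat.count_eq_card_filter_range]
      congr 1
      ext n
      simp only [mem_filter, ← ZMod.natCast_eq_natCast_iff, ZMod.natCast_zmod_val]
    rw [hc, Nat.count_modEq_card _ (Nat.pos_of_ne_zero (NeZero.ne d))]
    have hdm : (d : ℝ) * (N / d : ℕ) + (N % d : ℕ) = N := by exact_mod_cast Nat.div_add_mod N d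
    have hlt : ((N % d : ℕ) : ℝ) < d := by
      exact_mod_cast Nat.mod_lt N (Nat.pos_of_ne_zero (NeZero.ne d))
    have h0 : (0 : ℝ) ≤ (N % d : ℕ) := Nat.cast_nonneg _
    have hq : (N : ℝ) / d = (N / d : ℕ) + ((N % d : ℕ) : ℝ) / d := by
      rw [← hdm]; field_simp
    have hr1 : ((N % d : ℕ) : ℝ) / d < 1 := (div_lt_one hd).2 hlt
    have hr0 : 0 ≤ ((N % d : ℕ) : ℝ) / d := by positivity
    rw [hq, abs_le]
    split_ifs <;> constructor <;> push_cast <;> linarith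
  have h3 : (#{n ∈ range N | Q ((n : ℕ) : ZMod d)} : ℝ) - (#{t : ZMod d | Q t} : ℝ) / d * N =
      ∑ t : ZMod d with Q t, ((#{n ∈ range N | ((n : ℕ) : ZMod d) = t} : ℝ) - (N : ℝ) / d) := by
    rw [h1, sum_sub_distrib, sum_const, nsmul_eq_mul]
    push_cast
    ring
  rw [h3]
  calc _ ≤ ∑ t : ZMod d with Q t, |(#{n ∈ range N | ((n : ℕ) : ZMod d) = t} : ℝ) - (N : ℝ) / d| :=
        abs_sum_le_sum_abs _ _
    _ ≤ ∑ t : ZMod d with Q t, (1 : ℝ) := sum_le_sum fun t _ ↦ h2 t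
    _ = #{t : ZMod d | Q t} := by simp
    _ ≤ d := by
        have := card_filter_le (univ : Finset (ZMod d)) Q
        rw [card_univ, ZMod.card] at this
        exact_mod_cast this

end CountingSieve

section RootCount

open Finset

/-- The number of solutions of `(b + W t) (k (b + W t) + h) = 0` in `ZMod d`. -/
noncomputable def rootCount (W b k h : ℤ) (d : ℕ) : ℕ :=
  Nat.card {t : ZMod d // (b + W * t) * (k * (b + W * t) + h) = 0}

variable {W b k h : ℤ}

lemma rootCount_one : rootCount W b k h 1 = 1 := by
  rw [rootCount, Nat.card_eq_one_iff_unique]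
  exact ⟨inferInstance, ⟨⟨0, Subsingleton.elim _ _⟩⟩⟩

lemma rootCount_mul {m n : ℕ} (hmn : m.Coprime n) :
    rootCount W b k h (m * n) = rootCount W b k h m * rootCount W b k h n := by
  rw [rootCount, rootCount, rootCount, ← Nat.card_prod]
  refine Nat.card_congr (((ZMod.chineseRemainder hmn).toEquiv.subtypeEquiv
    (q := fun x ↦ (((b : ZMod m) + W * x.1) * (k * (b + W * x.1) + h) = 0) ∧
      (((b : ZMod n) + W * x.2) * (k * (b + W * x.2) + h) = 0)) ?_).trans
        (Equiv.subtypeProdEquivProd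
          (p := fun x : ZMod m ↦ (b + W * x) * (k * (b + W * x) + h) = 0)
          (q := fun x : ZMod n ↦ (b + W * x) * (k * (b + W * x) + h) = 0)))
  intro t
  rw [← map_eq_zero_iff (ZMod.chineseRemainder hmn) (ZMod.chineseRemainder hmn).injective]
  simp [Prod.ext_iff]

lemma rootCount_prime {p : ℕ} (hp : p.Prime) (hW : ¬ (p : ℤ) ∣ W) (hk : ¬ (p : ℤ) ∣ k) :
    rootCount W b k h p = if (p : ℤ) ∣ h then 1 else 2 := by
  have : Fact p.Prime := ⟨hp⟩
  have hW' : (W : ZMod p) ≠ 0 := by rwa [Ne, ZMod.intCast_zmod_eq_zero_iff_dvd]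
  have hk' : (k : ZMod p) ≠ 0 := by rwa [Ne, ZMod.intCast_zmod_eq_zero_iff_dvd]
  have hset : {t : ZMod p | (b + W * t) * (k * (b + W * t) + h) = 0} =
      (({-(b : ZMod p) / W, (-(h : ZMod p) / k - b) / W} : Finset (ZMod p)) : Set (ZMod p)) := by
    ext t
    simp only [Set.mem_ofPred_eq, mul_eq_zero, coe_insert, coe_singleton, Set.mem_insert_iff,
      Set.mem_singleton_iff]
    refine or_congr ?_ ?_
    · rw [eq_div_iff hW']
      constructor <;> intro h <;> linear_combination h
    · rw [eq_div_iff hW', eq_sub_iff_add_eq, eq_div_iff hk']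
      constructor <;> intro h <;> linear_combination h
  have hcard : rootCount W b k h p =
      #({-(b : ZMod p) / W, (-(h : ZMod p) / k - b) / W} : Finset (ZMod p)) := by
    rw [rootCount, ← Set.ncard_coe_finset, ← hset]
    rfl
  rw [hcard]
  have hiff : (-b / W : ZMod p) = (-h / k - b) / W ↔ (p : ℤ) ∣ h := by
    rw [div_left_inj' hW', ← ZMod.intCast_zmod_eq_zero_iff_dvd]
    constructor
    · intro h1
      have h2 : (-h / k : ZMod p) = 0 := by linear_combination -h1
      simpa [hk'] using h2
    · intro h1
      simp [h1]
  split_ifs with hph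
  · rw [hiff.2 hph]; simp
  · exact card_pair fun h1 ↦ hph (hiff.1 h1)

lemma rootCount_prod {D : Finset ℕ} (hD : ∀ p ∈ D, p.Prime) :
    rootCount W b k h (∏ p ∈ D, p) = ∏ p ∈ D, rootCount W b k h p := by
  induction D using Finset.induction_on with
  | empty => simpa using rootCount_one
  | insert p D hpD ih =>
    have hD' : ∀ q ∈ D, q.Prime := fun q hq ↦ hD q (mem_insert_of_mem hq)
    rw [prod_insert hpD, prod_insert hpD, rootCount_mul, ih hD']
    refine Nat.Coprime.prod_right fun q hq ↦ ?_
    exact (Nat.coprime_primes (hD p (mem_insert_self p D)) (hD' q hq)).2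
      (by rintro rfl; exact hpD hq)

end RootCount

section PrimePairs

open Finset

/-- The local density of the solutions of `(b + W t) (k (b + W t) + h) = 0` at a prime not
dividing `W k`. -/
noncomputable def pairDensity (h : ℤ) (p : ℕ) : ℝ := if (p : ℤ) ∣ h then 1 / p else 2 / p

/-- The local factors lost in the sieve for prime pairs when primes dividing `M` are not used. -/
noncomputable def pairLoss (M : ℕ) (h : ℤ) (p : ℕ) : ℝ :=
  if p ∣ M then ((1 - 1 / (p : ℝ)) ^ 2)⁻¹ else if (p : ℤ) ∣ h then (1 - 1 / (p : ℝ))⁻¹ else 1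

variable {M W b p z : ℕ} {k h : ℤ}

lemma one_sub_one_div_mem_Ioc (hp : p.Prime) : 1 - 1 / (p : ℝ) ∈ Set.Ioc 0 1 := by
  have hp1 : (1 : ℝ) < p := by exact_mod_cast hp.one_lt
  have : 1 / (p : ℝ) < 1 := (div_lt_one (by linarith)).2 hp1
  have : 0 < 1 / (p : ℝ) := by positivity
  constructor <;> linarith

lemma one_le_inv_one_sub_one_div (hp : p.Prime) : 1 ≤ (1 - 1 / (p : ℝ))⁻¹ :=
  (one_le_inv₀ (one_sub_one_div_mem_Ioc hp).1).2 (one_sub_one_div_mem_Ioc hp).2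

lemma one_le_inv_one_sub_one_div_sq (hp : p.Prime) : 1 ≤ ((1 - 1 / (p : ℝ)) ^ 2)⁻¹ := by
  rw [← inv_pow]
  exact one_le_pow₀ (one_le_inv_one_sub_one_div hp)

lemma pairDensity_pos (hp : p.Prime) : 0 < pairDensity h p := by
  have : (0 : ℝ) < p := by exact_mod_cast hp.pos
  unfold pairDensity
  split_ifs <;> positivity

lemma pairDensity_lt_one (hp : p.Prime) (hp2 : p ≠ 2) : pairDensity h p < 1 := by
  have : (2 : ℝ) < p := by exact_mod_cast lt_of_le_of_ne hp.two_le (Ne.symm hp2)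
  unfold pairDensity
  split_ifs
  · rw [div_lt_one] <;> linarith
  · rw [div_lt_one] <;> linarith

lemma one_le_pairLoss (hp : p.Prime) : 1 ≤ pairLoss M h p := by
  unfold pairLoss
  split_ifs
  exacts [one_le_inv_one_sub_one_div_sq hp, one_le_inv_one_sub_one_div hp, le_rfl]

lemma inv_sq_le_pairLoss_mul (hM : 2 ∣ M) (hp : p.Prime) :
    ((1 - 1 / (p : ℝ)) ^ 2)⁻¹ ≤ pairLoss M h p *
      (1 + if p ∣ M then 0 else pairDensity h p * (1 - pairDensity h p)⁻¹) := by
  have h1 := one_sub_one_div_mem_Ioc hp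
  by_cases hpM : p ∣ M
  · simp [pairLoss, hpM]
  have hp2 : p ≠ 2 := by rintro rfl; exact hpM hM
  have hlt := pairDensity_lt_one (h := h) hp hp2
  have hadd : 1 + pairDensity h p * (1 - pairDensity h p)⁻¹ = (1 - pairDensity h p)⁻¹ := by
    have : 1 - pairDensity h p ≠ 0 := by linarith
    field_simp
    ring
  rw [if_neg hpM, hadd]
  by_cases hph : (p : ℤ) ∣ h
  · simp only [pairLoss, pairDensity, hpM, hph, if_true, if_false]
    rw [sq, mul_inv]
  · simp only [pairDensity, hph, if_false] at hlt
    simp only [pairLoss, pairDensity, hpM, hph, if_false, one_mul]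
    refine inv_anti₀ (by linarith) ?_
    have : (2 : ℝ) / p = 2 * (1 / p) := by ring
    nlinarith [sq_nonneg (1 / (p : ℝ))]

lemma prod_ite_mem_le_prod {S U : Finset ℕ} {e : ℕ → ℝ} (he : ∀ p ∈ U, 1 ≤ e p) :
    ∏ p ∈ S, (if p ∈ U then e p else 1) ≤ ∏ p ∈ U, e p := by
  rw [prod_ite_mem]
  exact prod_le_prod_of_subset_of_one_le inter_subset_right
    (fun p hp ↦ zero_le_one.trans (he p (mem_inter.1 hp).2)) fun p hp _ ↦ he p hp

lemma prod_pairLoss_le {S : Finset ℕ} (hS : ∀ p ∈ S, p.Prime) (hW : W ≠ 0) (hk : k ≠ 0)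
    (hh : h ≠ 0) :
    ∏ p ∈ S, pairLoss (W * k.natAbs) h p ≤
      (∏ p ∈ W.primeFactors, ((1 - 1 / (p : ℝ)) ^ 2)⁻¹) *
      (∏ p ∈ k.natAbs.primeFactors, ((1 - 1 / (p : ℝ)) ^ 2)⁻¹) *
      (∏ p ∈ h.natAbs.primeFactors \ W.primeFactors, (1 - 1 / (p : ℝ))⁻¹) := by
  have hpr : ∀ {n p : ℕ}, p ∈ n.primeFactors → p.Prime := fun hp ↦ Nat.prime_of_mem_primeFactors hp
  have hE : ∀ (U : Finset ℕ) (e : ℕ → ℝ), (∀ p ∈ U, 1 ≤ e p) → ∀ p,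
      1 ≤ (if p ∈ U then e p else 1) := by
    intro U e he p
    split_ifs with hp
    exacts [he p hp, le_rfl]
  have hU1 : ∀ n : ℕ, ∀ p ∈ n.primeFactors, 1 ≤ ((1 - 1 / (p : ℝ)) ^ 2)⁻¹ :=
    fun n p hp ↦ one_le_inv_one_sub_one_div_sq (hpr hp)
  have hU2 : ∀ p ∈ h.natAbs.primeFactors \ W.primeFactors, 1 ≤ (1 - 1 / (p : ℝ))⁻¹ :=
    fun p hp ↦ one_le_inv_one_sub_one_div (hpr (mem_sdiff.1 hp).1)
  calc ∏ p ∈ S, pairLoss (W * k.natAbs) h p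
      ≤ ∏ p ∈ S, ((if p ∈ W.primeFactors then ((1 - 1 / (p : ℝ)) ^ 2)⁻¹ else 1) *
          (if p ∈ k.natAbs.primeFactors then ((1 - 1 / (p : ℝ)) ^ 2)⁻¹ else 1) *
          (if p ∈ h.natAbs.primeFactors \ W.primeFactors then (1 - 1 / (p : ℝ))⁻¹ else 1)) := by
        refine prod_le_prod (fun p hp ↦ zero_le_one.trans (one_le_pairLoss (hS p hp)))
          fun p hp ↦ ?_
        have hpp := hS p hp
        have e1 := hE _ _ (hU1 W) p
        have e2 := hE _ _ (hU1 k.natAbs) p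
        have e3 := hE _ _ hU2 p
        rw [pairLoss]
        by_cases hpM : p ∣ W * k.natAbs
        · rw [if_pos hpM]
          rcases (Nat.Prime.dvd_mul hpp).1 hpM with hd | hd
          · have hm : p ∈ W.primeFactors := Nat.mem_primeFactors.2 ⟨hpp, hd, hW⟩
            have := one_le_inv_one_sub_one_div_sq hpp
            rw [if_pos hm, mul_assoc]
            exact le_mul_of_one_le_right (by linarith) (one_le_mul_of_one_le_of_one_le e2 e3)
          · have hm : p ∈ k.natAbs.primeFactors :=
              Nat.mem_primeFactors.2 ⟨hpp, hd, Int.natAbs_ne_zero.2 hk⟩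
            have := one_le_inv_one_sub_one_div_sq hpp
            rw [if_pos hm, mul_right_comm]
            exact le_mul_of_one_le_left (by linarith) (one_le_mul_of_one_le_of_one_le e1 e3)
        rw [if_neg hpM]
        by_cases hph : (p : ℤ) ∣ h
        · rw [if_pos hph]
          have hm : p ∈ h.natAbs.primeFactors \ W.primeFactors := by
            refine mem_sdiff.2 ⟨Nat.mem_primeFactors.2
              ⟨hpp, Int.natCast_dvd.1 hph, Int.natAbs_ne_zero.2 hh⟩, fun hmem ↦ ?_⟩
            exact hpM (Dvd.dvd.mul_right (Nat.dvd_of_mem_primeFactors hmem) _)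
          have := one_le_inv_one_sub_one_div hpp
          rw [if_pos hm]
          exact le_mul_of_one_le_left (by linarith) (one_le_mul_of_one_le_of_one_le e1 e2)
        · rw [if_neg hph]
          exact one_le_mul_of_one_le_of_one_le (one_le_mul_of_one_le_of_one_le e1 e2) e3
    _ ≤ _ := by
        rw [prod_mul_distrib, prod_mul_distrib]
        have hnn : ∀ (U : Finset ℕ) (e : ℕ → ℝ), (∀ p ∈ U, 1 ≤ e p) →
            0 ≤ ∏ p ∈ S, (if p ∈ U then e p else 1) :=
          fun U e he ↦ prod_nonneg fun p _ ↦ zero_le_one.trans (hE U e he p)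
        have hnn' : ∀ (U : Finset ℕ) (e : ℕ → ℝ), (∀ p ∈ U, 1 ≤ e p) → 0 ≤ ∏ p ∈ U, e p :=
          fun U e he ↦ prod_nonneg fun p hp ↦ zero_le_one.trans (he p hp)
        exact mul_le_mul (mul_le_mul (prod_ite_mem_le_prod (hU1 W))
          (prod_ite_mem_le_prod (hU1 k.natAbs)) (hnn _ _ (hU1 k.natAbs)) (hnn' _ _ (hU1 W)))
          (prod_ite_mem_le_prod hU2) (hnn _ _ hU2)
          (mul_nonneg (hnn' _ _ (hU1 W)) (hnn' _ _ (hU1 k.natAbs)))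

/-- The product of the primes up to `z` that do not divide `M`. -/
def primesNotDvdProd (M z : ℕ) : ℕ := ∏ p ∈ Nat.primesLE z with ¬ p ∣ M, p

lemma primeFactors_primesNotDvdProd :
    (primesNotDvdProd M z).primeFactors = (Nat.primesLE z).filter (fun p ↦ ¬ p ∣ M) :=
  Nat.primeFactors_prod fun _ hp ↦ (Nat.mem_primesLE.1 (mem_filter.1 hp).1).2

lemma squarefree_primesNotDvdProd : Squarefree (primesNotDvdProd M z) := by
  refine Finset.squarefree_prod_of_pairwise_isCoprime ?_ ?_
  · intro p hp q hq hpq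
    have hp' := (Nat.mem_primesLE.1 (mem_filter.1 hp).1).2
    have hq' := (Nat.mem_primesLE.1 (mem_filter.1 hq).1).2
    exact Nat.coprime_iff_isRelPrime.1 ((Nat.coprime_primes hp' hq').2 hpq)
  · intro p hp
    exact (Nat.mem_primesLE.1 (mem_filter.1 hp).1).2.prime.squarefree

lemma Nat.Prime.dvd_primesNotDvdProd_iff (hp : p.Prime) :
    p ∣ primesNotDvdProd M z ↔ p ≤ z ∧ ¬ p ∣ M := by
  have : p ∈ (primesNotDvdProd M z).primeFactors ↔ p ∣ primesNotDvdProd M z := by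
    rw [Nat.mem_primeFactors]
    exact ⟨fun h ↦ h.2.1, fun h ↦ ⟨hp, h, squarefree_primesNotDvdProd.ne_zero⟩⟩
  rw [← this, primeFactors_primesNotDvdProd, mem_filter, Nat.mem_primesLE]
  tauto

/-- Sieve bound for the number of `n < N` for which `b + W n` and `k (b + W n) + h` are both free
of prime factors up to `y ^ 2` not dividing `W k`. -/
theorem card_coprime_pair_le (hW : Even W) (N : ℕ) {y : ℕ} (hy : 1 ≤ y) :
    (#{n ∈ range N | (primesNotDvdProd (W * k.natAbs) (y ^ 2)).Coprime
      (((b : ℤ) + W * (n : ℕ)) * (k * (b + W * (n : ℕ)) + h)).natAbs} : ℝ) ≤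
    N * (∏ p ∈ Nat.primesLE (y ^ 2), pairLoss (W * k.natAbs) h p) / Real.log (y + 1) ^ 2 +
      (y : ℝ) ^ 16 := by
  set M := W * k.natAbs with hM
  set P := primesNotDvdProd M (y ^ 2) with hPdef
  have hM2 : 2 ∣ M := hW.two_dvd.mul_right _
  have hP : Squarefree P := squarefree_primesNotDvdProd
  have hPM : ∀ p, p.Prime → p ∣ P → ¬ p ∣ M := fun p hp h ↦
    (hp.dvd_primesNotDvdProd_iff.1 h).2
  have hg1 : ∀ p, p.Prime → p ∣ P → pairDensity h p < 1 := by
    intro p hp hpP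
    refine pairDensity_lt_one hp ?_
    rintro rfl
    exact hPM 2 hp hpP hM2
  set s := countingSieve N (fun n ↦ (((b : ℤ) + W * (n : ℕ)) * (k * (b + W * (n : ℕ)) + h)).natAbs)
    hP (fun p hp _ ↦ pairDensity_pos (h := h) hp) hg1 with hs
  have hz : 1 ≤ y ^ 2 := Nat.one_le_pow _ _ hy
  have hnu_prime : ∀ p, p.Prime → s.nu p = pairDensity h p := by
    intro p hp
    change ArithmeticFunction.prodPrimeFactors _ p = _
    simp [ArithmeticFunction.prodPrimeFactors_apply hp.ne_zero, hp.primeFactors]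
  have hnu : ∀ d, d ∣ P → s.nu d = (rootCount W b k h d : ℝ) / d := by
    intro d hd
    have hdsq := hP.squarefree_of_dvd hd
    have hdprod := Nat.prod_primeFactors_of_squarefree hdsq
    rw [← BoundingSieve.prod_primeFactors_nu (s := s) hd]
    conv_rhs => rw [← hdprod]
    rw [rootCount_prod fun p hp ↦ Nat.prime_of_mem_primeFactors hp]
    push_cast
    rw [← prod_div_distrib]
    refine prod_congr rfl fun p hp ↦ ?_
    have hpp := Nat.prime_of_mem_primeFactors hp
    have hnM := hPM p hpp ((Nat.dvd_of_mem_primeFactors hp).trans hd)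
    rw [hnu_prime p hpp, pairDensity, rootCount_prime hpp
      (fun h1 ↦ hnM ((Int.natCast_dvd_natCast.1 h1).mul_right _))
      (fun h1 ↦ hnM ((Int.natCast_dvd.1 h1).mul_left _))]
    split_ifs <;> simp
  have hinv : ∀ d, d ∣ s.prodPrimes → (s.nu d)⁻¹ ≤ d := by
    intro d hd
    have h0 := BoundingSieve.nu_pos_of_dvd_prodPrimes hd
    rw [hnu d hd] at h0 ⊢
    have hr : rootCount W b k h d ≠ 0 := by
      intro h1
      simp [h1] at h0
    rw [inv_div]
    refine div_le_self (Nat.cast_nonneg _) ?_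
    exact_mod_cast Nat.one_le_iff_ne_zero.2 hr
  have hrem : ∀ d, d ∣ s.prodPrimes → |s.rem d| ≤ d := by
    intro d hd
    classical
    have : NeZero d := ⟨ne_zero_of_dvd_ne_zero BoundingSieve.prodPrimes_ne_zero hd⟩
    have key := abs_card_filter_zmod_sub_le N d
      (fun t ↦ ((b : ℤ) + (W : ℤ) * t) * (k * ((b : ℤ) + (W : ℤ) * t) + h) = 0)
    rw [BoundingSieve.rem, hnu d hd, hs, countingSieve_multSum]
    convert key using 3
    · congr 2
      refine filter_congr fun n _ ↦ ?_
      rw [← Int.natCast_dvd, ← ZMod.intCast_zmod_eq_zero_iff_dvd]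
      push_cast
      rfl
    · congr 2
      rw [rootCount, Nat.card_eq_fintype_card, Fintype.card_subtype]
  have hmain := BoundingSieve.siftedSum_le_div_selbergSum_add hz hinv hrem
  rw [hs, countingSieve_siftedSum, ← hs] at hmain
  have hprime : ∀ p ∈ Nat.primesLE (y ^ 2), p.Prime := fun p hp ↦ (Nat.mem_primesLE.1 hp).2
  have hlog := sq_log_le_prod_mul_powersetProdSum (y := y) (c := pairLoss M h)
    (a := fun p ↦ if p ∣ M then 0 else pairDensity h p * (1 - pairDensity h p)⁻¹)
    (by
      intro p hp
      split_ifs with hpM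
      · exact le_rfl
      · have hp2 : p ≠ 2 := by rintro rfl; exact hpM hM2
        have := pairDensity_lt_one (h := h) (hprime p hp) hp2
        have := pairDensity_pos (h := h) (hprime p hp)
        exact mul_nonneg (by linarith) (inv_nonneg.2 (by linarith)))
    (fun p hp ↦ one_le_pairLoss (hprime p hp))
    (fun p hp ↦ inv_sq_le_pairLoss_mul hM2 (hprime p hp))
  have hG := powersetProdSum_le_selbergSum s (S := Nat.primesLE (y ^ 2)) (y ^ 2)
    (a := fun p ↦ if p ∣ M then 0 else pairDensity h p * (1 - pairDensity h p)⁻¹) hprime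
    (by
      intro p hp hpP
      simp only [if_neg (hPM p (hprime p hp) hpP), hnu_prime p (hprime p hp)])
    (by
      intro p hp hpP
      by_cases hpM : p ∣ M
      · simp only [if_pos hpM]
      · exact absurd ((hprime p hp).dvd_primesNotDvdProd_iff.2
          ⟨(Nat.mem_primesLE.1 hp).1, hpM⟩) hpP)
  have hC : 0 ≤ ∏ p ∈ Nat.primesLE (y ^ 2), pairLoss M h p :=
    prod_nonneg fun p hp ↦ zero_le_one.trans (one_le_pairLoss (hprime p hp))
  have hGpos := BoundingSieve.selbergSum_pos (s := s) hz
  have hLpos : 0 < Real.log (y + 1) := Real.log_pos (by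
    have : (1 : ℝ) ≤ y := by exact_mod_cast hy
    linarith)
  have hdiv : s.totalMass / s.selbergSum (y ^ 2) ≤
      N * (∏ p ∈ Nat.primesLE (y ^ 2), pairLoss M h p) / Real.log (y + 1) ^ 2 := by
    change (N : ℝ) / _ ≤ _
    rw [div_le_div_iff₀ hGpos (by positivity), mul_assoc]
    refine mul_le_mul_of_nonneg_left (hlog.trans ?_) (Nat.cast_nonneg _)
    exact mul_le_mul_of_nonneg_left hG hC
  refine hmain.trans (add_le_add hdiv (le_of_eq ?_))
  push_cast
  ring

/-- Prime pairs in a progression are counted by the sieve, up to the small primes. -/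
lemma ncard_prime_pair_le (hk : k ≠ 0) (x : ℕ) :
    Nat.card {m : ℕ | 0 < m ∧ m ≤ x ∧ m ≡ b [MOD W] ∧ m.Prime ∧
      ((k * m + h : ℤ)).natAbs.Prime} ≤
    #{n ∈ range (x / W + 1) | (primesNotDvdProd M z).Coprime
      ((((b % W : ℕ) : ℤ) + W * (n : ℕ)) * (k * ((b % W : ℕ) + W * (n : ℕ)) + h)).natAbs} +
      (3 * z + 2) := by
  set A := {n ∈ range (x / W + 1) | (primesNotDvdProd M z).Coprime
      ((((b % W : ℕ) : ℤ) + W * (n : ℕ)) * (k * ((b % W : ℕ) + W * (n : ℕ)) + h)).natAbs} with hA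
  set A₁ := (range (x + 1)).filter fun m : ℕ ↦ (k * m + h).natAbs ≤ z with hA₁
  have hA₁card : #A₁ ≤ 2 * z + 1 := by
    have h1 : #A₁ ≤ #(Icc (-(z : ℤ)) z) := by
      refine card_le_card_of_injOn (fun m : ℕ ↦ k * m + h) ?_ ?_
      · intro m hm
        have := (mem_filter.1 hm).2
        simp only [coe_Icc, Set.mem_Icc]
        lia
      · intro m _ n _ hmn
        simpa [hk] using hmn
    rw [Int.card_Icc] at h1
    lia
  have hsub : {m : ℕ | 0 < m ∧ m ≤ x ∧ m ≡ b [MOD W] ∧ m.Prime ∧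
      ((k * m + h : ℤ)).natAbs.Prime} ⊆
      ((A.image (fun n ↦ b % W + W * n) ∪ (range (z + 1) ∪ A₁) : Finset ℕ) : Set ℕ) := by
    rintro m ⟨-, hmx, hmb, hmp, hmq⟩
    rw [mem_coe, mem_union, mem_union]
    by_cases h1 : m ≤ z
    · exact Or.inr (Or.inl (mem_range.2 (by lia)))
    by_cases h2 : (k * m + h).natAbs ≤ z
    · exact Or.inr (Or.inr (mem_filter.2 ⟨mem_range.2 (by lia), h2⟩))
    left
    have hm : b % W + W * (m / W) = m := by
      rw [← show m % W = b % W from hmb]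
      exact Nat.mod_add_div m W
    refine mem_image.2 ⟨m / W, mem_filter.2 ⟨?_, ?_⟩, hm⟩
    · exact mem_range.2 (Nat.lt_succ_of_le (Nat.div_le_div_right hmx))
    · have hm' : ((b % W : ℕ) : ℤ) + W * (m / W : ℕ) = m := by exact_mod_cast hm
      rw [hm', Int.natAbs_mul, Int.natAbs_natCast]
      have hcop : ∀ q : ℕ, q.Prime → ¬ q ≤ z → (primesNotDvdProd M z).Coprime q := by
        intro q hq hqz
        rw [Nat.coprime_comm, hq.coprime_iff_not_dvd, hq.dvd_primesNotDvdProd_iff]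
        exact fun h ↦ hqz h.1
      exact (hcop m hmp h1).mul_right (hcop _ hmq h2)
  calc _ ≤ #(A.image (fun n ↦ b % W + W * n) ∪ (range (z + 1) ∪ A₁)) := by
        rw [← Set.ncard_coe_finset]
        exact Set.ncard_le_ncard hsub (finite_toSet _)
    _ ≤ #A + (#(range (z + 1)) + #A₁) := by
        refine (card_union_le _ _).trans (add_le_add card_image_le (card_union_le _ _))
    _ ≤ #A + (3 * z + 2) := by
        rw [card_range]
        lia

end PrimePairs

lemma eventually_sieve_error_le (W : ℕ) : ∀ᶠ x : ℝ in Filter.atTop,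
    6 * x ^ (2 / 5 : ℝ) * (W * Real.log x ^ 2) ≤ x := by
  have h1 := (isLittleO_log_rpow_atTop (r := 1 / 5) (by norm_num)).bound zero_lt_one
  have h2 := (tendsto_rpow_atTop (y := 1 / 5) (by norm_num)).eventually_ge_atTop (6 * W : ℝ)
  filter_upwards [h1, h2, Filter.eventually_ge_atTop 1] with x h1 h2 hx
  have hx0 : 0 < x := by linarith
  have hl := Real.log_nonneg hx
  rw [one_mul, Real.norm_of_nonneg hl, Real.norm_of_nonneg (by positivity)] at h1
  set t := x ^ (1 / 5 : ℝ) with ht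
  have ht0 : 0 ≤ t := by positivity
  have e1 : x ^ (2 / 5 : ℝ) = t ^ 2 := by
    rw [ht, ← Real.rpow_natCast, ← Real.rpow_mul hx0.le]; norm_num
  have e2 : x = t ^ 5 := by
    rw [ht, ← Real.rpow_natCast, ← Real.rpow_mul hx0.le]; norm_num
  rw [e1]
  calc 6 * t ^ 2 * (W * Real.log x ^ 2) = (6 * W) * (t ^ 2 * Real.log x ^ 2) := by ring
    _ ≤ t * (t ^ 2 * t ^ 2) := by gcongr
    _ = x := by rw [e2]; ring

/-- Sieve corollary: for fixed nonzero `k` there is a constant `C` such that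
for integers `x, W, b ≥ 1` with `W` even and `x` sufficiently large depending on
`W` and `b`, and any nonzero `h`, the number of `0 < m ≤ x` with `m ≡ b (mod W)`
and `m`, `|k·m + h|` both prime is at most
`C · (x/(W log² x)) · ∏_{p ∣ W}(1-1/p)⁻² · ∏_{p ∣ h, p ∤ W}(1-1/p)⁻¹`. -/
theorem stmt_15 (k : ℤ) (hk : k ≠ 0) :
    ∃ C : ℝ, 0 < C ∧ ∀ W b : ℕ, 1 ≤ W → Even W → 1 ≤ b →
      ∃ x₀ : ℕ, ∀ x : ℕ, x₀ ≤ x → ∀ h : ℤ, h ≠ 0 →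
        (Nat.card {m : ℕ | 0 < m ∧ m ≤ x ∧ m ≡ b [MOD W] ∧ m.Prime ∧
            ((k * m + h : ℤ)).natAbs.Prime} : ℝ)
          ≤ C * ((x : ℝ) / (W * (Real.log x) ^ 2)) *
              (∏ p ∈ W.primeFactors, ((1 - 1 / (p : ℝ)) ^ 2)⁻¹) *
              (∏ p ∈ h.natAbs.primeFactors \ W.primeFactors,
                (1 - 1 / (p : ℝ))⁻¹) := by
  set K := ∏ p ∈ k.natAbs.primeFactors, ((1 - 1 / (p : ℝ)) ^ 2)⁻¹
  have hK : 1 ≤ K := Finset.one_le_prod fun p hp ↦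
    one_le_inv_one_sub_one_div_sq (Nat.prime_of_mem_primeFactors hp)
  refine ⟨3200 * K + 1, by linarith, fun W b hW hWe _ ↦ ?_⟩
  obtain ⟨x₁, hx₁⟩ := Filter.eventually_atTop.1 (eventually_sieve_error_le W)
  refine ⟨max ⌈x₁⌉₊ (max W 2), fun x hx h hh ↦ ?_⟩
  have hxx₁ : x₁ ≤ x := Nat.ceil_le.1 ((le_max_left _ _).trans hx)
  have hxW : W ≤ x := (le_max_left _ _).trans ((le_max_right _ _).trans hx)
  have hx2 : 2 ≤ x := (le_max_right _ _).trans ((le_max_right _ _).trans hx)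
  have herr := hx₁ x hxx₁
  have hxr : (2 : ℝ) ≤ x := by exact_mod_cast hx2
  have hWr : (0 : ℝ) < W := by exact_mod_cast hW
  have hL : 0 < Real.log x := Real.log_pos (by linarith)
  set A := ∏ p ∈ W.primeFactors, ((1 - 1 / (p : ℝ)) ^ 2)⁻¹
  set B := ∏ p ∈ h.natAbs.primeFactors \ W.primeFactors, (1 - 1 / (p : ℝ))⁻¹
  have hA : 1 ≤ A := Finset.one_le_prod fun p hp ↦
    one_le_inv_one_sub_one_div_sq (Nat.prime_of_mem_primeFactors hp)
  have hB : 1 ≤ B := Finset.one_le_prod fun p hp ↦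
    one_le_inv_one_sub_one_div (Nat.prime_of_mem_primeFactors (Finset.mem_sdiff.1 hp).1)
  set y := ⌊(x : ℝ) ^ (1 / 40 : ℝ)⌋₊
  have hy : 1 ≤ y := Nat.le_floor (by
    simpa using Real.one_le_rpow (by linarith : (1 : ℝ) ≤ x) (by norm_num : (0 : ℝ) ≤ 1 / 40))
  have hyr : (1 : ℝ) ≤ y := by exact_mod_cast hy
  have hy16 : (y : ℝ) ^ 16 ≤ (x : ℝ) ^ (2 / 5 : ℝ) := by
    calc (y : ℝ) ^ 16 ≤ ((x : ℝ) ^ (1 / 40 : ℝ)) ^ 16 := by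
          gcongr
          exact Nat.floor_le (by positivity)
      _ = (x : ℝ) ^ (2 / 5 : ℝ) := by
          rw [← Real.rpow_natCast, ← Real.rpow_mul (by positivity)]; norm_num
  have hlogy : Real.log x / 40 ≤ Real.log (y + 1) := by
    calc Real.log x / 40 = Real.log ((x : ℝ) ^ (1 / 40 : ℝ)) := by
          rw [Real.log_rpow (by linarith)]; ring
      _ ≤ Real.log (y + 1) :=
          Real.log_le_log (by positivity) (Nat.lt_floor_add_one _).le
  have hN : ((x / W + 1 : ℕ) : ℝ) ≤ 2 * (x / W) := by
    have h1 : ((x / W : ℕ) : ℝ) ≤ x / W := Nat.cast_div_le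
    have h2 : (1 : ℝ) ≤ x / W := (one_le_div hWr).2 (by exact_mod_cast hxW)
    push_cast
    linarith
  set Q := ∏ p ∈ Nat.primesLE (y ^ 2), pairLoss (W * k.natAbs) h p
  have hQ0 : 0 ≤ Q := Finset.prod_nonneg fun p hp ↦
    zero_le_one.trans (one_le_pairLoss (Nat.mem_primesLE.1 hp).2)
  have hQ : Q ≤ A * K * B :=
    prod_pairLoss_le (fun p hp ↦ (Nat.mem_primesLE.1 hp).2) (by lia) hk hh
  have hcount := ncard_prime_pair_le (W := W) (M := W * k.natAbs) (z := y ^ 2) (b := b) (h := h)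
    hk x
  have hsieve := card_coprime_pair_le (W := W) (b := b % W) (k := k) (h := h) hWe (x / W + 1) hy
  have hcount' := (Nat.cast_le (α := ℝ)).2 hcount
  rw [Nat.cast_add] at hcount'
  refine hcount'.trans ((add_le_add_left hsieve _).trans ?_)
  have hmain : ((x / W + 1 : ℕ) : ℝ) * Q / Real.log (y + 1) ^ 2 ≤
      3200 * K * (x / (W * Real.log x ^ 2)) * A * B := by
    calc ((x / W + 1 : ℕ) : ℝ) * Q / Real.log (y + 1) ^ 2
        ≤ 2 * (x / W) * (A * K * B) / (Real.log x / 40) ^ 2 := by gcongr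
      _ = 3200 * K * (x / (W * Real.log x ^ 2)) * A * B := by
          field_simp
          ring
  have hsmall : (y : ℝ) ^ 16 + ((3 * y ^ 2 + 2 : ℕ) : ℝ) ≤ x / (W * Real.log x ^ 2) := by
    rw [le_div_iff₀ (by positivity)]
    refine le_trans (mul_le_mul_of_nonneg_right ?_ (by positivity)) herr
    have h2 : (y : ℝ) ^ 2 ≤ (y : ℝ) ^ 16 := pow_le_pow_right₀ hyr (by norm_num)
    have h0 : (1 : ℝ) ≤ (y : ℝ) ^ 16 := one_le_pow₀ hyr
    push_cast
    linarith
  have hAB : x / (W * Real.log x ^ 2) ≤ x / (W * Real.log x ^ 2) * A * B := by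
    rw [mul_assoc]
    exact le_mul_of_one_le_right (by positivity) (one_le_mul_of_one_le_of_one_le hA hB)
  calc _ ≤ 3200 * K * (x / (W * Real.log x ^ 2)) * A * B +
        x / (W * Real.log x ^ 2) * A * B := by linarith
    _ = _ := by ring
end

section
/- Let K, M ≥ 1 be integers with M ≥ K. Then there exists a finite set of primes P, partitioned as P = ⋃_{2 ≤ a ≤ K} P_a (disjoint union), together with an injective assignment p ↦ q_p of primes, such that: (i) for each 2 ≤ a ≤ K and p ∈ P_a, q_p ≥ M·p and a^p ≡ 1 (mod q_p); and (ii) ∑_{p ∈ P_a} 1/p ≥ M for each 2 ≤ a ≤ K. -/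
open Filter Topology ArithmeticFunction.vonMangoldt in
/-- The sum of the reciprocals of the primes in an invertible residue class diverges. -/
lemma not_summable_one_div_prime_residueClass {m : ℕ} [NeZero m] {a : ZMod m} (ha : IsUnit a) :
    ¬ Summable fun n : ℕ ↦ if n.Prime ∧ (n : ZMod m) = a then (1 : ℝ) / n else 0 := by
  intro H
  set f : ℕ → ℝ := fun n ↦ if n.Prime ∧ (n : ZMod m) = a then (1 : ℝ) / n else 0 with hf
  have hf0 (n : ℕ) : 0 ≤ f n := by simp only [hf]; split_ifs <;> positivity
  set g : ℕ → ℝ := fun n ↦ (if n.Prime then 0 else residueClass a n) / n with hg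
  have hgs : Summable g := summable_residueClass_non_primes_div a
  have hg0 (n : ℕ) : 0 ≤ g n := by
    simp only [hg]; have := residueClass_nonneg a n; split_ifs <;> positivity
  set h : ℝ → ℕ → ℝ := fun s n ↦ f n * (s * Real.log n * (n : ℝ) ^ (-s)) with hh
  have hbound {s : ℝ} (hs : 0 < s) (n : ℕ) : ‖h s n‖ ≤ f n := by
    rcases n.eq_zero_or_pos with rfl | hn
    · simp [hh, hf0]
    have hn' : (0 : ℝ) < n := mod_cast hn
    have hlog : 0 ≤ Real.log n := Real.log_natCast_nonneg n
    have hle := Real.log_le_rpow_div hn'.le hs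
    rw [le_div_iff₀ hs] at hle
    have h1 : s * Real.log n * (n : ℝ) ^ (-s) ≤ 1 := by
      rw [Real.rpow_neg hn'.le, ← div_eq_mul_inv, div_le_one (by positivity)]
      linarith
    have h0 : 0 ≤ s * Real.log n * (n : ℝ) ^ (-s) := by positivity
    rw [Real.norm_of_nonneg (mul_nonneg (hf0 n) h0)]
    exact mul_le_of_le_one_right (hf0 n) h1
  have hlim : Tendsto (fun s ↦ ∑' n, h s n) (𝓝[>] 0) (𝓝 (∑' _ : ℕ, (0 : ℝ))) := by
    refine tendsto_tsum_of_dominated_convergence H (fun n ↦ ?_) ?_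
    · rcases n.eq_zero_or_pos with rfl | hn
      · simp [hh]
      have hc : Continuous fun s : ℝ ↦ h s n := by
        have : Continuous fun s : ℝ ↦ (n : ℝ) ^ (-s) :=
          continuous_const.rpow continuous_neg fun _ ↦ Or.inl (by positivity)
        simp only [hh]
        fun_prop
      simpa [hh] using (hc.tendsto 0).mono_left nhdsWithin_le_nhds
    · filter_upwards [self_mem_nhdsWithin] with s hs n using hbound hs n
  obtain ⟨C, hC⟩ := LSeries_residueClass_lower_bound ha
  have hupper {s : ℝ} (hs : s ∈ Set.Ioc 0 1) :
      (m.totient : ℝ)⁻¹ - s * C ≤ s * ∑' n, g n + ∑' n, h s n := by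
    have hs0 : 0 < s := hs.1
    have hsum : Summable (h s) := .of_norm_bounded H (hbound hs0)
    have hterm (n : ℕ) : s * (residueClass a n / (n : ℝ) ^ (1 + s)) ≤ s * g n + h s n := by
      rcases n.eq_zero_or_pos with rfl | hn
      · simp [hg, hh, hf]
      have hn1 : (1 : ℝ) ≤ n := mod_cast hn
      have hn' : (0 : ℝ) < n := by positivity
      have hpow : (1 : ℝ) ≤ (n : ℝ) ^ s := Real.one_le_rpow hn1 hs0.le
      rw [Real.rpow_add hn', Real.rpow_one]
      by_cases hp : n.Prime
      · by_cases hr : (n : ZMod m) = a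
        · have hv : residueClass a n = Real.log n := by
            simp [residueClass, hr, ArithmeticFunction.vonMangoldt_apply_prime hp]
          simp only [hg, hh, hf, hp, hr, hv, and_self, if_true, zero_div, mul_zero, zero_add]
          rw [Real.rpow_neg hn'.le]
          apply le_of_eq
          field_simp
        · simp [hg, hh, hf, residueClass, hr]
      · have : residueClass a n / (n * (n : ℝ) ^ s) ≤ residueClass a n / n := by
          have := residueClass_nonneg a n
          gcongr
          exact le_mul_of_one_le_right hn'.le hpow
        simp only [hg, hh, hf, hp, false_and, if_false, zero_mul, add_zero]
        gcongr
    have hL := hC (x := 1 + s) ⟨by linarith, by linarith [hs.2]⟩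
    rw [add_sub_cancel_left] at hL
    have hrhs : Summable fun n ↦ s * g n + h s n := (hgs.mul_left s).add hsum
    calc (m.totient : ℝ)⁻¹ - s * C = s * ((m.totient : ℝ)⁻¹ / s - C) := by field_simp
      _ ≤ s * ∑' n, residueClass a n / (n : ℝ) ^ (1 + s) := by gcongr
      _ = ∑' n, s * (residueClass a n / (n : ℝ) ^ (1 + s)) := tsum_mul_left.symm
      _ ≤ ∑' n, (s * g n + h s n) := by
          refine Summable.tsum_le_tsum hterm (.of_nonneg_of_le (fun n ↦ ?_) hterm hrhs) hrhs
          have := residueClass_nonneg a n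
          positivity
      _ = s * ∑' n, g n + ∑' n, h s n := by
          rw [(hgs.mul_left s).tsum_add hsum, tsum_mul_left]
  have hid : Tendsto (fun s : ℝ ↦ s) (𝓝[>] 0) (𝓝 0) := nhdsWithin_le_nhds
  have hle := le_of_tendsto_of_tendsto ((hid.mul_const C).const_sub (m.totient : ℝ)⁻¹)
    ((hid.mul_const (∑' n, g n)).add hlim)
    (by filter_upwards [Ioc_mem_nhdsGT one_pos] with s hs using hupper hs)
  have hpos : 0 < (m.totient : ℝ)⁻¹ := inv_pos.mpr (mod_cast m.totient.pos_of_neZero)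
  simp only [zero_mul, sub_zero, tsum_zero, add_zero] at hle
  exact hpos.not_ge hle

/-- Finitely many primes in an invertible residue class, all exceeding a given bound, can have an
arbitrarily large sum of reciprocals. -/
lemma exists_finset_primes_residueClass_le_sum {m : ℕ} [NeZero m] {a : ZMod m} (ha : IsUnit a)
    (N : ℕ) (B : ℝ) :
    ∃ S : Finset ℕ, (∀ p ∈ S, p.Prime ∧ (p : ZMod m) = a ∧ N < p) ∧
      B ≤ ∑ p ∈ S, (1 : ℝ) / p := by
  set f : ℕ → ℝ := fun n ↦ if n.Prime ∧ (n : ZMod m) = a then (1 : ℝ) / n else 0 with hf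
  have hf0 (n : ℕ) : 0 ≤ f n := by simp only [hf]; split_ifs <;> positivity
  have htop := (not_summable_iff_tendsto_nat_atTop_of_nonneg hf0).mp
    (not_summable_one_div_prime_residueClass ha)
  obtain ⟨n, hnN, hn⟩ := ((Filter.eventually_ge_atTop (N + 1)).and
    (htop.eventually_ge_atTop (B + ∑ i ∈ Finset.range (N + 1), f i))).exists
  refine ⟨{p ∈ Finset.Ico (N + 1) n | p.Prime ∧ (p : ZMod m) = a}, fun p hp ↦ ?_, ?_⟩
  · simp only [Finset.mem_filter, Finset.mem_Ico] at hp
    exact ⟨hp.2.1, hp.2.2, by omega⟩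
  · rw [Finset.sum_filter]
    have := Finset.sum_range_add_sum_Ico f hnN
    linarith

/-- If `p` is a prime congruent to `1` modulo `M!`, and `p > a ≥ 2`, then some prime `q ≥ M * p`
has the property that `a` has order `p` modulo `q`. -/
lemma exists_prime_orderOf_eq_of_modEq_factorial {M a p : ℕ} (ha : 2 ≤ a) (hp : p.Prime)
    (hap : a < p) (hpM : (p : ZMod M.factorial) = 1) :
    ∃ q : ℕ, q.Prime ∧ M * p ≤ q ∧ orderOf (a : ZMod q) = p := by
  set G := ∑ i ∈ Finset.range p, a ^ i with hG
  have hG1 : G ≠ 1 := by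
    have : ∑ i ∈ Finset.range 2, a ^ i ≤ G :=
      Finset.sum_le_sum_of_subset (Finset.range_subset_range.mpr hp.two_le)
    simp [Finset.sum_range_succ] at this
    omega
  obtain ⟨q, hq, hqG⟩ := Nat.exists_prime_and_dvd hG1
  have : Fact q.Prime := ⟨hq⟩
  have : Fact p.Prime := ⟨hp⟩
  have hsum : ∑ i ∈ Finset.range p, (a : ZMod q) ^ i = 0 := by
    have := (ZMod.natCast_eq_zero_iff G q).mpr hqG
    rw [hG] at this
    exact_mod_cast this
  have hpow : (a : ZMod q) ^ p = 1 := by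
    rw [← sub_eq_zero, ← mul_geom_sum, hsum, mul_zero]
  have hord_dvd (h : orderOf (a : ZMod q) = p) : p ∣ q - 1 :=
    h ▸ ZMod.orderOf_dvd_card_sub_one fun h0 ↦ by simp [h0, hp.ne_zero] at hpow
  have hne : (a : ZMod q) ≠ 1 := by
    intro h1
    have hqp : q = p := by
      refine (Nat.prime_dvd_prime_iff_eq hq hp).mp ((ZMod.natCast_eq_zero_iff p q).mp ?_)
      simpa [h1] using hsum
    have : (a : ZMod q) = (1 : ℕ) := by simpa using h1
    rw [ZMod.natCast_eq_natCast_iff'] at this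
    rw [Nat.mod_eq_of_lt (hqp ▸ hap), Nat.mod_eq_of_lt hq.one_lt] at this
    omega
  have hord : orderOf (a : ZMod q) = p := orderOf_eq_prime hpow hne
  refine ⟨q, hq, ?_, hord⟩
  obtain ⟨k, hk⟩ := hord_dvd hord
  have hqk : q = p * k + 1 := by have := hq.one_lt; omega
  by_contra! hlt
  have hkM : k < M := by
    by_contra! h
    have := Nat.mul_le_mul_right p h
    rw [hqk, mul_comm p k] at hlt
    omega
  have hdvd : k + 1 ∣ q := by
    have h1 : p ≡ 1 [MOD k + 1] := by
      refine Nat.ModEq.of_dvd (Nat.dvd_factorial k.succ_pos hkM) ?_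
      exact (ZMod.natCast_eq_natCast_iff _ _ _).mp (by simpa using hpM)
    have h2 : q ≡ 1 * k + 1 [MOD k + 1] := hqk ▸ (h1.mul_right k).add_right 1
    rw [one_mul] at h2
    exact (h2.dvd_iff dvd_rfl).mpr dvd_rfl
  rcases hq.eq_one_or_self_of_dvd _ hdvd with h | h
  · have : k = 0 := by omega
    simp [this] at hqk
    exact hq.ne_one hqk
  · have hk0 : k ≠ 0 := by
      rintro rfl
      simp at hqk
      exact hq.ne_one hqk
    have : 2 * k ≤ p * k := Nat.mul_le_mul_right k hp.two_le
    omega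


/-- Key lemma: for integers `M ≥ K ≥ 1` there are finite disjoint sets of primes
`P_a` for `2 ≤ a ≤ K` and an assignment `p ↦ q_p` of primes, injective on the
union, with `q_p ≥ M·p` and `a^p ≡ 1 (mod q_p)` for `p ∈ P_a`, and
`∑_{p ∈ P_a} 1/p ≥ M` for each `a`. -/
theorem stmt_17 (K M : ℕ) (hK : 1 ≤ K) (hM : K ≤ M) :
    ∃ (Pa : ℕ → Finset ℕ) (q : ℕ → ℕ),
      (∀ a ∈ Finset.Icc 2 K, ∀ p ∈ Pa a, p.Prime) ∧
      (∀ a ∈ Finset.Icc 2 K, ∀ a' ∈ Finset.Icc 2 K, a ≠ a' →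
        Disjoint (Pa a) (Pa a')) ∧
      Set.InjOn q ↑((Finset.Icc 2 K).biUnion Pa) ∧
      (∀ a ∈ Finset.Icc 2 K, ∀ p ∈ Pa a,
        (q p).Prime ∧ M * p ≤ q p ∧ a ^ p ≡ 1 [MOD q p]) ∧
      (∀ a ∈ Finset.Icc 2 K, (M : ℝ) ≤ ∑ p ∈ Pa a, (1 : ℝ) / p) := by
  have hM1 : 1 ≤ M := hK.trans hM
  clear hM
  have : NeZero M.factorial := ⟨M.factorial_ne_zero⟩
  induction K, hK using Nat.le_induction with
  | base => exact ⟨fun _ ↦ ∅, id, by simp⟩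
  | succ K hK ih =>
    obtain ⟨Pa, q, hprime, hdisj, hinj, hq, hsum⟩ := ih
    set U := (Finset.Icc 2 K).biUnion Pa with hU
    obtain ⟨S, hS, hSsum⟩ := exists_finset_primes_residueClass_le_sum
      (isUnit_one (M := ZMod M.factorial)) (U.sup id ⊔ U.sup q ⊔ (K + 1)) M
    have hS' : ∀ p ∈ S, ∃ r : ℕ, r.Prime ∧ M * p ≤ r ∧ orderOf ((K + 1 : ℕ) : ZMod r) = p :=
      fun p hp ↦ exists_prime_orderOf_eq_of_modEq_factorial (by omega) (hS p hp).1
        ((le_max_right _ _).trans_lt (hS p hp).2.2) (hS p hp).2.1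
    choose! r hr_prime hr_le hr_ord using hS'
    have hUS : ∀ u ∈ U, ∀ p ∈ S, u < p := fun u hu p hp ↦
      ((Finset.le_sup (f := id) hu).trans (le_sup_left.trans le_sup_left)).trans_lt (hS p hp).2.2
    have hqS : ∀ u ∈ U, ∀ p ∈ S, q u < p := fun u hu p hp ↦
      ((Finset.le_sup (f := q) hu).trans (le_sup_right.trans le_sup_left)).trans_lt (hS p hp).2.2
    have hSU : ∀ p ∈ S, p ∉ U := fun p hp hu ↦ (hUS p hu p hp).false
    have hIcc : Finset.Icc 2 (K + 1) = insert (K + 1) (Finset.Icc 2 K) := by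
      ext; simp; omega
    have hmemU {a p : ℕ} (ha : a ∈ Finset.Icc 2 K) (hp : p ∈ Pa a) : p ∈ U :=
      Finset.mem_biUnion.mpr ⟨a, ha, hp⟩
    have hne {a : ℕ} (ha : a ∈ Finset.Icc 2 K) : a ≠ K + 1 := by
      have := (Finset.mem_Icc.mp ha).2
      omega
    have hold {a : ℕ} (ha : a ∈ Finset.Icc 2 K) : Function.update Pa (K + 1) S a = Pa a :=
      Function.update_of_ne (hne ha) _ _
    have hdS {a : ℕ} (ha : a ∈ Finset.Icc 2 K) : Disjoint (Pa a) S :=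
      Finset.disjoint_left.mpr fun p hp hpS ↦ hSU p hpS (hmemU ha hp)
    have hr_gt : ∀ p ∈ S, ∀ u ∈ U, q u < r p := fun p hp u hu ↦
      (hqS u hu p hp).trans_le <| (Nat.le_mul_of_pos_left p (by omega)).trans (hr_le p hp)
    have hbU : (Finset.Icc 2 (K + 1)).biUnion (Function.update Pa (K + 1) S) = S ∪ U := by
      rw [hIcc, Finset.biUnion_insert, Function.update_self,
        Finset.biUnion_congr rfl fun a ha ↦ hold ha]
    refine ⟨Function.update Pa (K + 1) S, fun p ↦ if p ∈ U then q p else r p, ?_, ?_, ?_, ?_, ?_⟩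
    · rw [hIcc, Finset.forall_mem_insert, Function.update_self]
      exact ⟨fun p hp ↦ (hS p hp).1, fun a ha ↦ by rw [hold ha]; exact hprime a ha⟩
    · rw [hIcc]
      intro a ha a' ha' haa'
      rcases Finset.mem_insert.mp ha with rfl | ha <;>
        rcases Finset.mem_insert.mp ha' with rfl | ha'
      · exact absurd rfl haa'
      · rw [Function.update_self, hold ha']; exact (hdS ha').symm
      · rw [Function.update_self, hold ha]; exact hdS ha
      · rw [hold ha, hold ha']; exact hdisj a ha a' ha' haa'
    · rw [hbU]
      intro x hx y hy hxy
      simp only [Finset.coe_union, Set.mem_union, Finset.mem_coe] at hx hy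
      dsimp only at hxy
      rcases hx with hx | hx <;> rcases hy with hy | hy
      · rw [if_neg (hSU x hx), if_neg (hSU y hy)] at hxy
        rw [← hr_ord x hx, ← hr_ord y hy, hxy]
      · rw [if_neg (hSU x hx), if_pos hy] at hxy
        exact absurd hxy (hr_gt x hx y hy).ne'
      · rw [if_pos hx, if_neg (hSU y hy)] at hxy
        exact absurd hxy (hr_gt y hy x hx).ne
      · rw [if_pos hx, if_pos hy] at hxy
        exact hinj hx hy hxy
    · rw [hIcc, Finset.forall_mem_insert, Function.update_self]
      refine ⟨fun p hp ↦ ?_, fun a ha p hp ↦ ?_⟩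
      · beta_reduce
        rw [if_neg (hSU p hp)]
        refine ⟨hr_prime p hp, hr_le p hp, (ZMod.natCast_eq_natCast_iff _ _ _).mp ?_⟩
        have := pow_orderOf_eq_one ((K + 1 : ℕ) : ZMod (r p))
        rw [hr_ord p hp] at this
        rw [Nat.cast_pow, this, Nat.cast_one]
      · rw [hold ha] at hp
        beta_reduce
        rw [if_pos (hmemU ha hp)]
        exact hq a ha p hp
    · rw [hIcc, Finset.forall_mem_insert, Function.update_self]
      exact ⟨hSsum, fun a ha ↦ by rw [hold ha]; exact hsum a ha⟩
end

section
/- For any even integer W ≥ 2 and any b coprime to W, the number of primes p ≤ x with p ≡ b (mod W) such that p + 2 is also prime is O( x / (φ(W) · (log x)²) · ∏_{p | W, p odd} (1 - 1/p)^{-1} ) for x sufficiently large depending on W. -/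
lemma sum_range_mul_of_periodic {a b : ℕ} (hab : a.Coprime b) (ha : 0 < a) (hb : 0 < b)
    {f g : ℕ → ℝ} (hf : Function.Periodic f a) (hg : Function.Periodic g b) :
    ∑ m ∈ Finset.range (a * b), f m * g m =
      (∑ i ∈ Finset.range a, f i) * ∑ j ∈ Finset.range b, g j := by
  rw [Finset.sum_mul_sum, ← Finset.sum_product']
  refine Finset.sum_nbij (fun m => (m % a, m % b)) ?_ ?_ ?_ ?_
  · intro m _
    simp [Nat.mod_lt _ ha, Nat.mod_lt _ hb]
  · intro m hm n hn h
    simp only [Prod.mk.injEq] at h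
    have := (Nat.modEq_and_modEq_iff_modEq_mul hab).1 h
    simp only [Finset.coe_range, Set.mem_Iio] at hm hn
    exact this.eq_of_lt_of_lt hm hn
  · rintro ⟨i, j⟩ hij
    simp only [Finset.coe_product, Finset.coe_range, Set.mem_prod, Set.mem_Iio] at hij
    refine ⟨Nat.chineseRemainder hab i j, ?_, ?_⟩
    · simpa using Nat.chineseRemainder_lt_mul hab i j ha.ne' hb.ne'
    · have := (Nat.chineseRemainder hab i j).2
      simp only [Nat.ModEq, Nat.mod_eq_of_lt hij.1, Nat.mod_eq_of_lt hij.2] at this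
      simp [this.1, this.2]
  · intro m _
    simp [hf.map_mod_nat, hg.map_mod_nat]

lemma periodic_prod {T : Finset ℕ} {f : ℕ → ℕ → ℝ}
    (hf : ∀ p ∈ T, Function.Periodic (f p) p) :
    Function.Periodic (fun m => ∏ p ∈ T, f p m) (∏ p ∈ T, p) := by
  intro m
  refine Finset.prod_congr rfl fun p hp => ?_
  obtain ⟨k, hk⟩ := Finset.dvd_prod_of_mem (fun q : ℕ => q) hp
  rw [hk, mul_comm]
  exact (hf p hp).nat_mul k m

lemma sum_range_prod_of_periodic {T : Finset ℕ} (hT : ∀ p ∈ T, p.Prime) {f : ℕ → ℕ → ℝ}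
    (hf : ∀ p ∈ T, Function.Periodic (f p) p) :
    ∑ m ∈ Finset.range (∏ p ∈ T, p), ∏ p ∈ T, f p m =
      ∏ p ∈ T, ∑ m ∈ Finset.range p, f p m := by
  induction T using Finset.induction_on with
  | empty => simp
  | insert q T hq ih =>
    simp only [Finset.forall_mem_insert] at hT hf
    simp only [Finset.prod_insert hq]
    rw [← ih hT.2 hf.2]
    refine sum_range_mul_of_periodic ?_ hT.1.pos (Finset.prod_pos fun p hp => (hT.2 p hp).pos)
      hf.1 (periodic_prod hf.2)
    refine Nat.Coprime.prod_right fun p hp => (Nat.coprime_primes hT.1 (hT.2 p hp)).2 ?_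
    rintro rfl
    exact hq hp

lemma abs_sum_range_sub_le_of_periodic {f : ℕ → ℝ} {d : ℕ} (hd : 0 < d)
    (hf : Function.Periodic f d) {B : ℝ} (hB : ∀ m, |f m| ≤ B) (N : ℕ) :
    |∑ m ∈ Finset.range N, f m - N / d * ∑ m ∈ Finset.range d, f m| ≤ 2 * d * B := by
  have hB0 : 0 ≤ B := (abs_nonneg _).trans (hB 0)
  have hd' : (0 : ℝ) < d := by exact_mod_cast hd
  have short (n : ℕ) (hn : n ≤ d) : |∑ m ∈ Finset.range n, f m| ≤ d * B := by
    refine (Finset.abs_sum_le_sum_abs _ _).trans ?_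
    refine (Finset.sum_le_card_nsmul _ _ B fun m _ => hB m).trans ?_
    simp only [Finset.card_range, nsmul_eq_mul]
    gcongr
  induction N using Nat.strong_induction_on with
  | _ N ih =>
    rcases lt_or_ge N d with h | h
    · have h1 := short N h.le
      have h2 : |(N : ℝ) / d * ∑ m ∈ Finset.range d, f m| ≤ d * B := by
        rw [abs_mul, abs_of_nonneg (by positivity)]
        have h3 : (N : ℝ) / d ≤ 1 := by
          rw [div_le_one hd']
          exact_mod_cast h.le
        exact (mul_le_of_le_one_left (abs_nonneg _) h3).trans (short d le_rfl)
      rw [abs_le] at h1 h2 ⊢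
      constructor <;> linarith [h1.1, h1.2, h2.1, h2.2]
    · obtain ⟨n, rfl⟩ := Nat.exists_eq_add_of_le h
      convert ih n (by omega) using 2
      rw [Finset.sum_range_add]
      have : ∀ m, f (d + m) = f m := fun m => by rw [add_comm]; exact hf m
      simp only [this]
      push_cast
      field_simp
      ring

theorem selberg_upper_bound {e : ℕ → ℕ → ℝ} {g : ℕ → ℝ} {𝓓 : Finset ℕ} {D : ℕ}
    (hone : 1 ∈ 𝓓) (hD : ∀ d ∈ 𝓓, d ≤ D) (hsq : ∀ d ∈ 𝓓, Squarefree d)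
    (hg : ∀ d ∈ 𝓓, ∀ p ∈ d.primeFactors, 0 < g p)
    (hper : ∀ d ∈ 𝓓, ∀ p ∈ d.primeFactors, Function.Periodic (e p) p)
    (hle : ∀ d ∈ 𝓓, ∀ p ∈ d.primeFactors, ∀ m, |e p m| ≤ p)
    (hmean : ∀ d ∈ 𝓓, ∀ p ∈ d.primeFactors, ∑ m ∈ Finset.range p, e p m = 0)
    (hvar : ∀ d ∈ 𝓓, ∀ p ∈ d.primeFactors, ∑ m ∈ Finset.range p, e p m ^ 2 = p / g p)
    (N : ℕ) {S : Finset ℕ} (hS : S ⊆ Finset.range N)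
    (hSe : ∀ m ∈ S, ∀ d ∈ 𝓓, ∀ p ∈ d.primeFactors, e p m = 1) :
    (S.card : ℝ) ≤ N / (∑ d ∈ 𝓓, ∏ p ∈ d.primeFactors, g p) + 2 * (D : ℝ) ^ 6 := by
  classical
  set γ : ℕ → ℝ := fun d => ∏ p ∈ d.primeFactors, g p with hγ
  set G : ℝ := ∑ d ∈ 𝓓, γ d with hG
  have γpos : ∀ d ∈ 𝓓, 0 < γ d := fun d hd => Finset.prod_pos fun p hp => hg d hd p hp
  have Gpos : 0 < G := Finset.sum_pos γpos ⟨1, hone⟩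
  set h : ℕ → ℝ := fun d => γ d / G with hh
  have hpos : ∀ d ∈ 𝓓, 0 ≤ h d := fun d hd => (div_pos (γpos d hd) Gpos).le
  have hle1 : ∀ d ∈ 𝓓, h d ≤ 1 := fun d hd =>
    (div_le_one Gpos).2 (Finset.single_le_sum (fun i hi => (γpos i hi).le) hd)
  have hsum : ∑ d ∈ 𝓓, h d = 1 := by
    rw [← Finset.sum_div, div_self Gpos.ne']
  set E : ℕ → ℕ → ℝ := fun d m => ∏ p ∈ d.primeFactors, e p m with hE
  set Φ : ℕ → ℝ := fun m => ∑ d ∈ 𝓓, h d * E d m with hΦ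
  have hΦS : ∀ m ∈ S, Φ m = 1 := by
    intro m hm
    rw [← hsum]
    refine Finset.sum_congr rfl fun d hd => ?_
    rw [hE]
    simp only
    rw [Finset.prod_eq_one fun p hp => hSe m hm d hd p hp, mul_one]
  have step1 : (S.card : ℝ) ≤ ∑ m ∈ Finset.range N, Φ m ^ 2 := by
    calc (S.card : ℝ) = ∑ m ∈ S, Φ m ^ 2 := by
          rw [Finset.sum_congr rfl fun m hm => by rw [hΦS m hm]]; simp
      _ ≤ _ := Finset.sum_le_sum_of_subset_of_nonneg hS fun _ _ _ => sq_nonneg _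
  have prodEq : ∀ d ∈ 𝓓, ∏ p ∈ d.primeFactors, p = d := fun d hd =>
    Nat.prod_primeFactors_of_squarefree (hsq d hd)
  have prodCast : ∀ d ∈ 𝓓, ∏ p ∈ d.primeFactors, (p : ℝ) = d := fun d hd => by
    rw [← Nat.cast_prod, prodEq d hd]
  have inner : ∀ d ∈ 𝓓, ∀ d' ∈ 𝓓, ∑ m ∈ Finset.range N, E d m * E d' m ≤
      (if d = d' then N / γ d else 0) + 2 * (D : ℝ) ^ 4 := by
    intro d hd d' hd'
    set L := d.primeFactors
    set L' := d'.primeFactors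
    set f : ℕ → ℕ → ℝ := fun p m =>
      (if p ∈ L then e p m else 1) * (if p ∈ L' then e p m else 1) with hf
    have hfE : ∀ m, E d m * E d' m = ∏ p ∈ L ∪ L', f p m := by
      intro m
      simp only [hf, Finset.prod_mul_distrib, Finset.prod_ite_mem, hE]
      rw [Finset.inter_eq_right.2 Finset.subset_union_left,
        Finset.inter_eq_right.2 Finset.subset_union_right]
    have hprime : ∀ p ∈ L ∪ L', p.Prime := by
      intro p hp
      rcases Finset.mem_union.1 hp with hp | hp <;> exact Nat.prime_of_mem_primeFactors hp
    have hfper : ∀ p ∈ L ∪ L', Function.Periodic (f p) p := by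
      intro p hp m
      have : e p (m + p) = e p m := by
        rcases Finset.mem_union.1 hp with hp | hp
        · exact hper d hd p hp m
        · exact hper d' hd' p hp m
      simp only [hf, this]
    have hEle : ∀ d ∈ 𝓓, ∀ m, |E d m| ≤ D := by
      intro d hd m
      rw [hE]
      simp only
      rw [Finset.abs_prod]
      calc _ ≤ ∏ p ∈ d.primeFactors, (p : ℝ) :=
            Finset.prod_le_prod (fun _ _ => abs_nonneg _) fun p hp => hle d hd p hp m
        _ = d := prodCast d hd
        _ ≤ D := by exact_mod_cast hD d hd
    have hbound : ∀ m, |∏ p ∈ L ∪ L', f p m| ≤ (D : ℝ) ^ 2 := by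
      intro m
      rw [← hfE, abs_mul, sq]
      exact mul_le_mul (hEle d hd m) (hEle d' hd' m) (abs_nonneg _) (by positivity)
    have hperiod : ((∏ p ∈ L ∪ L', p : ℕ) : ℝ) ≤ (D : ℝ) ^ 2 := by
      have h1 : (∏ p ∈ L ∪ L', p) ∣ (∏ p ∈ L, p) * ∏ p ∈ L', p := by
        rw [← Finset.prod_union_inter]
        exact dvd_mul_right _ _
      rw [prodEq d hd, prodEq d' hd'] at h1
      have h2 := Nat.le_of_dvd
        (Nat.mul_pos (hsq d hd).ne_zero.bot_lt (hsq d' hd').ne_zero.bot_lt) h1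
      have h3 := h2.trans (Nat.mul_le_mul (hD d hd) (hD d' hd'))
      rw [← sq] at h3
      exact_mod_cast h3
    have hdpos : 0 < ∏ p ∈ L ∪ L', p := Finset.prod_pos fun p hp => (hprime p hp).pos
    have key := abs_sum_range_sub_le_of_periodic hdpos (periodic_prod hfper) hbound N
    rw [sum_range_prod_of_periodic hprime hfper] at key
    simp only [← hfE] at key
    have main : (N : ℝ) / (∏ p ∈ L ∪ L', p : ℕ) * ∏ p ∈ L ∪ L', ∑ m ∈ Finset.range p, f p m =
        if d = d' then N / γ d else 0 := by
      split_ifs with hdd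
      · subst hdd
        have : ∏ p ∈ L ∪ L, ∑ m ∈ Finset.range p, f p m = ∏ p ∈ L, ((p : ℝ) / g p) := by
          rw [Finset.union_self]
          refine Finset.prod_congr rfl fun p hp => ?_
          rw [← hvar d hd p hp]
          simp only [hf, L', if_pos hp, sq]
          simp only [L] at hp
          simp only [if_pos hp]
        have hd0 : (d : ℝ) ≠ 0 := by exact_mod_cast (hsq d hd).ne_zero
        rw [this, Finset.prod_div_distrib, Finset.union_self, prodEq d hd, prodCast d hd]
        have := (γpos d hd).ne'
        change _ / _ * (_ / γ d) = _
        field_simp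
      · have hLL : L ≠ L' := fun hLL => hdd <| by
          rw [← prodEq d hd, ← prodEq d' hd']
          exact congrArg (fun L : Finset ℕ => ∏ p ∈ L, p) hLL
        have : ∃ p ∈ L ∪ L', ∑ m ∈ Finset.range p, f p m = 0 := by
          by_contra! hne
          apply hLL
          ext p
          constructor
          · intro hp
            by_contra hp'
            apply hne p (Finset.mem_union_left _ hp)
            simpa [hf, hp, hp'] using hmean d hd p hp
          · intro hp
            by_contra hp'
            apply hne p (Finset.mem_union_right _ hp)
            simpa [hf, hp, hp'] using hmean d' hd' p hp
        obtain ⟨p, hp, hp0⟩ := this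
        exact mul_eq_zero_of_right _ (Finset.prod_eq_zero hp hp0)
    rw [main] at key
    have h1 := (abs_le.1 key).2
    have h2 : 2 * ((∏ p ∈ L ∪ L', p : ℕ) : ℝ) * (D : ℝ) ^ 2 ≤ 2 * (D : ℝ) ^ 2 * (D : ℝ) ^ 2 := by
      gcongr
    have h3 : 2 * (D : ℝ) ^ 2 * (D : ℝ) ^ 2 = 2 * (D : ℝ) ^ 4 := by ring
    linarith
  have hcard : (𝓓.card : ℝ) ≤ D := by
    have : 𝓓 ⊆ Finset.Icc 1 D := fun d hd =>
      Finset.mem_Icc.2 ⟨(hsq d hd).ne_zero.bot_lt, hD d hd⟩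
    simpa using Finset.card_le_card this
  calc (S.card : ℝ) ≤ ∑ m ∈ Finset.range N, Φ m ^ 2 := step1
    _ = ∑ d ∈ 𝓓, ∑ d' ∈ 𝓓, h d * h d' * ∑ m ∈ Finset.range N, E d m * E d' m := by
        simp only [hΦ, sq, Finset.sum_mul_sum]
        rw [Finset.sum_comm]
        refine Finset.sum_congr rfl fun d _ => ?_
        rw [Finset.sum_comm]
        refine Finset.sum_congr rfl fun d' _ => ?_
        rw [Finset.mul_sum]
        exact Finset.sum_congr rfl fun m _ => by ring
    _ ≤ ∑ d ∈ 𝓓, ∑ d' ∈ 𝓓, ((if d = d' then h d * h d' * (N / γ d) else 0) + 2 * (D : ℝ) ^ 4) := by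
        refine Finset.sum_le_sum fun d hd => Finset.sum_le_sum fun d' hd' => ?_
        have h0 := mul_nonneg (hpos d hd) (hpos d' hd')
        refine (mul_le_mul_of_nonneg_left (inner d hd d' hd') h0).trans ?_
        rw [mul_add, mul_ite, mul_zero]
        refine add_le_add_right ?_ _
        exact mul_le_of_le_one_left (by positivity)
          (mul_le_one₀ (hle1 d hd) (hpos d' hd') (hle1 d' hd'))
    _ = N / G + (𝓓.card : ℝ) ^ 2 * (2 * (D : ℝ) ^ 4) := by
        simp only [Finset.sum_add_distrib, Finset.sum_ite_eq, Finset.sum_const, nsmul_eq_mul]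
        congr 1
        · calc _ = ∑ d ∈ 𝓓, h d * (N / G) := by
                refine Finset.sum_congr rfl fun d hd => ?_
                have := (γpos d hd).ne'
                rw [if_pos hd]
                simp only [hh]
                field_simp
            _ = N / G := by rw [← Finset.sum_mul, hsum, one_mul]
        · ring
    _ ≤ N / G + (D : ℝ) ^ 2 * (2 * (D : ℝ) ^ 4) := by gcongr
    _ = _ := by ring

lemma sum_le_sum_of_injOn_of_nonneg {ι κ : Type*} {s : Finset ι} {t : Finset κ} (i : ι → κ)
    (hi : ∀ x ∈ s, i x ∈ t) (hinj : Set.InjOn i s) {f : ι → ℝ} {g : κ → ℝ}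
    (hfg : ∀ x ∈ s, f x ≤ g (i x)) (hg : ∀ y ∈ t, 0 ≤ g y) :
    ∑ x ∈ s, f x ≤ ∑ y ∈ t, g y := by
  classical
  calc _ ≤ ∑ x ∈ s, g (i x) := Finset.sum_le_sum hfg
    _ = ∑ y ∈ s.image i, g y := (Finset.sum_image hinj).symm
    _ ≤ _ := Finset.sum_le_sum_of_subset_of_nonneg (Finset.image_subset_iff.2 hi)
      fun y hy _ => hg y hy

lemma sum_Icc_one_div_sq_le_two (n : ℕ) : ∑ k ∈ Finset.Icc 1 n, 1 / (k : ℝ) ^ 2 ≤ 2 := by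
  have h := sum_Ioo_inv_sq_le (α := ℝ) 0 (n + 1)
  have : Finset.Ioo 0 (n + 1) = Finset.Icc 1 n := by ext; simp; omega
  rw [this] at h
  simpa using h

/-- The squarefree positive integers up to `y` coprime to `W`. -/
def squarefreeCoprime (W y : ℕ) : Finset ℕ :=
  (Finset.Icc 1 y).filter fun d => Squarefree d ∧ d.Coprime W

lemma mem_squarefreeCoprime {W y d : ℕ} :
    d ∈ squarefreeCoprime W y ↔ (1 ≤ d ∧ d ≤ y) ∧ Squarefree d ∧ d.Coprime W := by
  simp [squarefreeCoprime]

lemma sum_coprime_one_div_le (W y : ℕ) :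
    ∑ k ∈ Finset.Icc 1 y with k.Coprime W, 1 / (k : ℝ) ≤
      2 * ∑ s ∈ squarefreeCoprime W y, 1 / (s : ℝ) := by
  choose a b hab ha using Nat.sq_mul_squarefree
  calc _ ≤ ∑ z ∈ squarefreeCoprime W y ×ˢ Finset.Icc 1 y, 1 / (z.1 : ℝ) * (1 / (z.2 : ℝ) ^ 2) := by
        refine sum_le_sum_of_injOn_of_nonneg (fun k => (a k, b k)) ?_ ?_ ?_ ?_
        · intro k hk
          simp only [Finset.mem_filter, Finset.mem_Icc] at hk
          have hb0 : 0 < b k := by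
            rcases Nat.eq_zero_or_pos (b k) with h | h
            · have := hab k
              rw [h] at this
              simp at this
              omega
            · exact h
          have ha0 : 0 < a k := (ha k).ne_zero.bot_lt
          have had : a k ∣ k := Dvd.intro_left _ (hab k)
          have hbd : b k ∣ k := (dvd_pow_self _ two_ne_zero).trans (Dvd.intro _ (hab k))
          simp only [Finset.mem_product, mem_squarefreeCoprime, Finset.mem_Icc]
          exact ⟨⟨⟨ha0, (Nat.le_of_dvd hk.1.1 had).trans hk.1.2⟩, ha k,
            hk.2.coprime_dvd_left had⟩, hb0, (Nat.le_of_dvd hk.1.1 hbd).trans hk.1.2⟩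
        · intro k _ l _ h
          simp only [Prod.mk.injEq] at h
          rw [← hab k, ← hab l, h.1, h.2]
        · intro k _
          have : (k : ℝ) = (b k : ℝ) ^ 2 * a k := by exact_mod_cast (hab k).symm
          rw [this, mul_comm, one_div_mul_one_div]
        · intro z _
          positivity
    _ = (∑ s ∈ squarefreeCoprime W y, 1 / (s : ℝ)) * ∑ k ∈ Finset.Icc 1 y, 1 / (k : ℝ) ^ 2 := by
        rw [Finset.sum_mul_sum, Finset.sum_product]
    _ ≤ (∑ s ∈ squarefreeCoprime W y, 1 / (s : ℝ)) * 2 := by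
        gcongr
        exact sum_Icc_one_div_sq_le_two y
    _ = _ := mul_comm _ _

lemma card_divisorsAntidiagonal_of_squarefree {d : ℕ} (hd : Squarefree d) :
    (d.divisorsAntidiagonal).card = 2 ^ d.primeFactors.card := by
  rw [← Nat.map_div_right_divisors, Finset.card_map, Nat.card_divisors hd.ne_zero,
    ← Finset.prod_const]
  refine Finset.prod_congr rfl fun p hp => ?_
  rw [Nat.factorization_eq_one_of_squarefree hd (Nat.prime_of_mem_primeFactors hp)
    (Nat.dvd_of_mem_primeFactors hp)]

lemma sq_sum_squarefreeCoprime_le (W y : ℕ) :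
    (∑ s ∈ squarefreeCoprime W y, 1 / (s : ℝ)) ^ 2 ≤
      2 * ∑ d ∈ squarefreeCoprime W (y ^ 2), 2 ^ d.primeFactors.card / (d : ℝ) := by
  rw [sq, Finset.sum_mul_sum, ← Finset.sum_product']
  calc _ ≤ ∑ z ∈ Finset.Icc 1 y ×ˢ
          (squarefreeCoprime W (y ^ 2)).sigma fun d => d.divisorsAntidiagonal,
          1 / (z.1 : ℝ) ^ 2 * (1 / (z.2.1 : ℝ)) := by
        refine sum_le_sum_of_injOn_of_nonneg
          (fun z => (z.1.gcd z.2, ⟨(z.1 / z.1.gcd z.2) * (z.2 / z.1.gcd z.2),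
            (z.1 / z.1.gcd z.2, z.2 / z.1.gcd z.2)⟩)) ?_ ?_ ?_ ?_
        · rintro ⟨s, t⟩ hst
          simp only [Finset.mem_product, mem_squarefreeCoprime] at hst
          obtain ⟨⟨⟨hs1, hsy⟩, hs, hsW⟩, ⟨ht1, hty⟩, ht, htW⟩ := hst
          have hc := Nat.gcd_pos_of_pos_left t hs1
          have hu : s / s.gcd t ∣ s := Nat.div_dvd_of_dvd (Nat.gcd_dvd_left s t)
          have hv : t / s.gcd t ∣ t := Nat.div_dvd_of_dvd (Nat.gcd_dvd_right s t)
          have hu0 := Nat.pos_of_dvd_of_pos hu hs1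
          have hv0 := Nat.pos_of_dvd_of_pos hv ht1
          simp only [Finset.mem_product, Finset.mem_sigma, mem_squarefreeCoprime,
            Finset.mem_Icc, Nat.mem_divisorsAntidiagonal, true_and]
          refine ⟨⟨hc, (Nat.gcd_le_left t hs1).trans hsy⟩, ⟨⟨Nat.mul_pos hu0 hv0, ?_⟩, ?_, ?_⟩,
            (Nat.mul_pos hu0 hv0).ne'⟩
          · rw [sq]
            exact Nat.mul_le_mul ((Nat.div_le_self _ _).trans hsy)
              ((Nat.div_le_self _ _).trans hty)
          · exact (Nat.squarefree_mul (Nat.coprime_div_gcd_div_gcd hc)).2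
              ⟨hs.squarefree_of_dvd hu, ht.squarefree_of_dvd hv⟩
          · exact (hsW.coprime_dvd_left hu).mul_left (htW.coprime_dvd_left hv)
        · rintro ⟨s, t⟩ _ ⟨s', t'⟩ _ h
          simp only [Prod.mk.injEq, Sigma.mk.injEq] at h
          obtain ⟨hc, -, h⟩ := h
          simp only [heq_eq_eq, Prod.mk.injEq] at h
          rw [Prod.mk.injEq]
          constructor
          · rw [← Nat.div_mul_cancel (Nat.gcd_dvd_left s t), h.1, hc,
              Nat.div_mul_cancel (Nat.gcd_dvd_left s' t')]
          · rw [← Nat.div_mul_cancel (Nat.gcd_dvd_right s t), h.2, hc,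
              Nat.div_mul_cancel (Nat.gcd_dvd_right s' t')]
        · rintro ⟨s, t⟩ _
          have hs : (s : ℝ) = (s / s.gcd t : ℕ) * (s.gcd t : ℕ) := by
            exact_mod_cast (Nat.div_mul_cancel (Nat.gcd_dvd_left s t)).symm
          have ht : (t : ℝ) = (t / s.gcd t : ℕ) * (s.gcd t : ℕ) := by
            exact_mod_cast (Nat.div_mul_cancel (Nat.gcd_dvd_right s t)).symm
          simp only [one_div_mul_one_div]
          apply le_of_eq
          congr 1
          conv_lhs => rw [hs, ht]
          push_cast
          ring
        · intro z _
          positivity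
    _ = (∑ k ∈ Finset.Icc 1 y, 1 / (k : ℝ) ^ 2) *
          ∑ d ∈ squarefreeCoprime W (y ^ 2), 2 ^ d.primeFactors.card / (d : ℝ) := by
        rw [Finset.sum_product, Finset.sum_mul]
        refine Finset.sum_congr rfl fun k _ => ?_
        dsimp only
        rw [← Finset.mul_sum, Finset.sum_sigma]
        congr 1
        refine Finset.sum_congr rfl fun d hd => ?_
        dsimp only
        rw [Finset.sum_const, card_divisorsAntidiagonal_of_squarefree (mem_squarefreeCoprime.1 hd).2.1,
          nsmul_eq_mul]
        push_cast
        ring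
    _ ≤ _ := by
        gcongr
        exact sum_Icc_one_div_sq_le_two y

lemma totient_div_mul_harmonic_le {W : ℕ} (hW : 0 < W) (J : ℕ) :
    (W.totient : ℝ) / W * (harmonic J : ℝ) ≤
      ∑ k ∈ Finset.Ico 1 (J * W + 1) with W.Coprime k, 1 / (k : ℝ) := by
  induction J with
  | zero => simp
  | succ J ih =>
    have hsplit : Finset.Ico 1 ((J + 1) * W + 1) =
        Finset.Ico 1 (J * W + 1) ∪ Finset.Ico (J * W + 1) (J * W + 1 + W) := by
      rw [Finset.Ico_union_Ico_eq_Ico (by omega) (by omega)]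
      congr 1
      ring
    rw [hsplit, Finset.filter_union, Finset.sum_union, harmonic_succ]
    · have hblock : (W.totient : ℝ) * (1 / ((J + 1) * W)) ≤
          ∑ k ∈ Finset.Ico (J * W + 1) (J * W + 1 + W) with W.Coprime k, 1 / (k : ℝ) := by
        rw [← Nat.filter_coprime_Ico_eq_totient W (J * W + 1), ← nsmul_eq_mul]
        refine Finset.card_nsmul_le_sum _ _ _ fun k hk => ?_
        simp only [Finset.mem_filter, Finset.mem_Ico] at hk
        have h1 : 0 < k := by omega
        have h2 : k ≤ (J + 1) * W := by linarith [hk.1.2]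
        gcongr
        exact_mod_cast h2
      have hW' : (W : ℝ) ≠ 0 := by exact_mod_cast hW.ne'
      calc _ = (W.totient : ℝ) / W * (harmonic J : ℝ) + W.totient * (1 / ((J + 1) * W)) := by
            push_cast
            field_simp
        _ ≤ _ := add_le_add ih hblock
    · exact Finset.disjoint_filter_filter (Finset.Ico_disjoint_Ico_consecutive _ _ _)

lemma totient_div_mul_log_le {W y : ℕ} (hW : 0 < W) (hy : W ^ 2 ≤ y) :
    (W.totient : ℝ) / W * (Real.log y / 2) ≤
      ∑ k ∈ Finset.Icc 1 y with k.Coprime W, 1 / (k : ℝ) := by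
  have hW' : (0 : ℝ) < W := by exact_mod_cast hW
  have hy0 : 0 < y := lt_of_lt_of_le (by positivity) hy
  have hy' : (0 : ℝ) < y := by exact_mod_cast hy0
  have h1 : Real.log y / 2 ≤ Real.log (y / W : ℝ) := by
    have h2 : Real.log ((W : ℝ) ^ 2) ≤ Real.log y :=
      Real.log_le_log (by positivity) (by exact_mod_cast hy)
    rw [Real.log_pow] at h2
    rw [Real.log_div hy'.ne' hW'.ne']
    push_cast at h2
    linarith
  have h2 : Real.log (y / W : ℝ) ≤ (harmonic (y / W) : ℝ) := by
    refine le_trans (Real.log_le_log (by positivity) ?_) (log_add_one_le_harmonic (y / W))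
    rw [div_le_iff₀ hW']
    exact_mod_cast (Nat.lt_mul_of_div_lt (Nat.lt_succ_self _) hW).le
  calc _ ≤ (W.totient : ℝ) / W * (harmonic (y / W) : ℝ) := by gcongr; exact h1.trans h2
    _ ≤ _ := totient_div_mul_harmonic_le hW _
    _ ≤ _ := by
      refine Finset.sum_le_sum_of_subset_of_nonneg ?_ fun _ _ _ => by positivity
      intro k hk
      simp only [Finset.mem_filter, Finset.mem_Ico, Finset.mem_Icc] at hk ⊢
      have := Nat.div_mul_le_self y W
      exact ⟨⟨hk.1.1, by omega⟩, hk.2.symm⟩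

lemma sq_totient_mul_log_le {W y : ℕ} (hW : 0 < W) (hy : W ^ 2 ≤ y) :
    ((W.totient : ℝ) / W * Real.log y) ^ 2 ≤
      32 * ∑ d ∈ squarefreeCoprime W (y ^ 2), 2 ^ d.primeFactors.card / (d : ℝ) := by
  have h1 := (totient_div_mul_log_le hW hy).trans (sum_coprime_one_div_le W y)
  have h2 := sq_sum_squarefreeCoprime_le W y
  have h0 : 0 ≤ (W.totient : ℝ) / W * (Real.log y / 2) := by
    have := Real.log_natCast_nonneg y
    positivity
  have h3 := pow_le_pow_left₀ h0 h1 2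
  nlinarith

lemma card_roots_mod_prime {p W b : ℕ} (hp : p.Prime) (hp2 : p ≠ 2) (hpW : p.Coprime W) :
    ((Finset.range p).filter fun m => p ∣ (b + W * m) * (b + W * m + 2)).card = 2 := by
  have := Fact.mk hp
  have hW : (W : ZMod p) ≠ 0 := by
    rw [Ne, ZMod.natCast_eq_zero_iff]
    exact (hp.coprime_iff_not_dvd).1 hpW
  have h2 : (2 : ZMod p) ≠ 0 := by
    have : ¬ p ∣ 2 := fun h => hp2 ((Nat.prime_dvd_prime_iff_eq hp Nat.prime_two).1 h)
    rw [← ZMod.natCast_eq_zero_iff] at this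
    exact_mod_cast this
  set r : ZMod p := -b / W with hr
  set s : ZMod p := -(b + 2) / W with hs
  have hrs : r ≠ s := by
    intro h
    rw [hr, hs, div_left_inj' hW] at h
    apply h2
    linear_combination h
  have : ((Finset.range p).filter fun m => p ∣ (b + W * m) * (b + W * m + 2)) =
      {r.val, s.val} := by
    ext m
    have root (t : ZMod p) (hm : m < p) : m = t.val ↔ (m : ZMod p) = t := by
      constructor
      · rintro rfl
        exact ZMod.natCast_zmod_val t
      · rintro rfl
        exact (ZMod.val_cast_of_lt hm).symm
    simp only [Finset.mem_filter, Finset.mem_range, Finset.mem_insert, Finset.mem_singleton]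
    constructor
    · rintro ⟨hm, h⟩
      rw [root r hm, root s hm, hr, hs, eq_div_iff hW, eq_div_iff hW]
      rw [← ZMod.natCast_eq_zero_iff] at h
      push_cast at h
      rcases mul_eq_zero.1 h with h | h
      · left; linear_combination h
      · right; linear_combination h
    · intro h
      have hm : m < p := by rcases h with rfl | rfl <;> exact ZMod.val_lt _
      refine ⟨hm, ?_⟩
      rw [root r hm, root s hm, hr, hs, eq_div_iff hW, eq_div_iff hW] at h
      rw [← ZMod.natCast_eq_zero_iff]
      push_cast
      rcases h with h | h
      · exact mul_eq_zero_of_left (by linear_combination h) _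
      · exact mul_eq_zero_of_right _ (by linear_combination h)
  rw [this, Finset.card_pair fun h => hrs (ZMod.val_injective p h)]

theorem twin_sieve_bound {W : ℕ} (hWe : Even W) (b N D : ℕ) (hD : 1 ≤ D)
    {S : Finset ℕ} (hS : S ⊆ Finset.range N)
    (hSp : ∀ m ∈ S, ∀ p, p.Prime → p ≤ D → ¬ p ∣ (b + W * m) * (b + W * m + 2)) :
    (S.card : ℝ) ≤
      N / (∑ d ∈ squarefreeCoprime W D, 2 ^ d.primeFactors.card / (d : ℝ)) + 2 * (D : ℝ) ^ 6 := by
  set e : ℕ → ℕ → ℝ := fun p m =>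
    if p ∣ (b + W * m) * (b + W * m + 2) then 1 - (p : ℝ) / 2 else 1 with he
  have hmem : ∀ d ∈ squarefreeCoprime W D, ∀ p ∈ d.primeFactors,
      p.Prime ∧ p ≤ D ∧ p.Coprime W ∧ p ≠ 2 := by
    intro d hd p hp
    rw [mem_squarefreeCoprime] at hd
    have hpd := Nat.dvd_of_mem_primeFactors hp
    have hpW := hd.2.2.coprime_dvd_left hpd
    refine ⟨Nat.prime_of_mem_primeFactors hp, (Nat.le_of_dvd hd.1.1 hpd).trans hd.1.2, hpW, ?_⟩
    rintro rfl
    exact (Nat.prime_two.coprime_iff_not_dvd.1 hpW) hWe.two_dvd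
  have hp3 : ∀ d ∈ squarefreeCoprime W D, ∀ p ∈ d.primeFactors, (3 : ℝ) ≤ p := by
    intro d hd p hp
    obtain ⟨h1, -, -, h2⟩ := hmem d hd p hp
    have := h1.two_le
    exact_mod_cast (by omega : 3 ≤ p)
  have hsum (p : ℕ) (u v : ℝ) (hp : p.Prime) (hp2 : p ≠ 2) (hpW : p.Coprime W) :
      ∑ m ∈ Finset.range p, (if p ∣ (b + W * m) * (b + W * m + 2) then u else v) =
        2 * u + (p - 2) * v := by
    have hc := card_roots_mod_prime (b := b) hp hp2 hpW
    have hc' := Finset.card_filter_add_card_filter_not (s := Finset.range p)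
      (fun m => p ∣ (b + W * m) * (b + W * m + 2))
    rw [hc, Finset.card_range] at hc'
    rw [Finset.sum_ite, Finset.sum_const, Finset.sum_const, hc, nsmul_eq_mul, nsmul_eq_mul]
    have hc'' : (2 : ℝ) + ((Finset.range p).filter fun m =>
        ¬ p ∣ (b + W * m) * (b + W * m + 2)).card = p := by exact_mod_cast hc'
    rw [← hc'']
    push_cast
    ring
  have key := selberg_upper_bound (e := e) (g := fun p => 2 / ((p : ℝ) - 2))
    (𝓓 := squarefreeCoprime W D) (D := D) (by simp [mem_squarefreeCoprime, hD])
    (fun d hd => (mem_squarefreeCoprime.1 hd).1.2) (fun d hd => (mem_squarefreeCoprime.1 hd).2.1)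
    (fun d hd p hp => by
      have := hp3 d hd p hp
      exact div_pos two_pos (by linarith))
    (fun d hd p hp m => by
      have : p ∣ (b + W * (m + p)) * (b + W * (m + p) + 2) ↔
          p ∣ (b + W * m) * (b + W * m + 2) := by
        have h : (b + W * (m + p)) * (b + W * (m + p) + 2) =
          (b + W * m) * (b + W * m + 2) + p * (W * (2 * (b + W * m) + 2 + W * p)) := by ring
        rw [h, Nat.dvd_add_left (dvd_mul_right _ _)]
      simp only [he, this])
    (fun d hd p hp m => by
      have := hp3 d hd p hp
      simp only [he]
      split_ifs <;> rw [abs_le] <;> constructor <;> linarith)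
    (fun d hd p hp => by
      obtain ⟨h1, -, h2, h3⟩ := hmem d hd p hp
      simp only [he]
      rw [hsum p _ _ h1 h3 h2]
      ring)
    (fun d hd p hp => by
      obtain ⟨h1, -, h2, h3⟩ := hmem d hd p hp
      have := hp3 d hd p hp
      have h4 : (p : ℝ) - 2 ≠ 0 := by linarith
      simp only [he, ite_pow]
      rw [hsum p _ _ h1 h3 h2]
      field_simp
      ring)
    N hS
    (fun m hm d hd p hp => by
      obtain ⟨h1, h2, -, -⟩ := hmem d hd p hp
      exact if_neg (hSp m hm p h1 h2))
  refine key.trans ?_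
  gcongr with d hd
  · refine Finset.sum_pos (fun d hd => ?_) ⟨1, by simp [mem_squarefreeCoprime, hD]⟩
    have : (0 : ℝ) < d := by exact_mod_cast (mem_squarefreeCoprime.1 hd).1.1
    positivity
  · have hprod : (d : ℝ) = ∏ p ∈ d.primeFactors, (p : ℝ) := by
      rw [← Nat.cast_prod,
        Nat.prod_primeFactors_of_squarefree (mem_squarefreeCoprime.1 hd).2.1]
    rw [hprod, ← Finset.prod_const, ← Finset.prod_div_distrib]
    refine Finset.prod_le_prod (fun _ _ => by positivity) fun p hp => ?_
    have := hp3 d hd p hp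
    gcongr <;> linarith

lemma self_div_totient_eq {W : ℕ} (hWe : Even W) (hW : 0 < W) :
    (W : ℝ) / W.totient =
      2 * ∏ p ∈ W.primeFactors.filter (fun p => Odd p), (1 - 1 / (p : ℝ))⁻¹ := by
  have htot : (W.totient : ℝ) = W * ∏ p ∈ W.primeFactors, (1 - 1 / (p : ℝ)) := by
    have := congrArg (fun q : ℚ => (q : ℝ)) (Nat.totient_eq_mul_prod_factors W)
    push_cast at this
    simpa using this
  have heven : W.primeFactors.filter (fun p => ¬ Odd p) = {2} := by
    ext p
    simp only [Finset.mem_filter, Nat.mem_primeFactors, Finset.mem_singleton,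
      Nat.not_odd_iff_even]
    constructor
    · rintro ⟨⟨hp, -, -⟩, he⟩
      exact hp.even_iff.1 he
    · rintro rfl
      exact ⟨⟨Nat.prime_two, hWe.two_dvd, hW.ne'⟩, even_two⟩
  rw [← Finset.prod_filter_mul_prod_filter_not _ (fun p => Odd p), heven,
    Finset.prod_singleton] at htot
  have hW' : (W : ℝ) ≠ 0 := by exact_mod_cast hW.ne'
  rw [htot, Finset.prod_inv_distrib]
  set P := ∏ p ∈ W.primeFactors.filter (fun p => Odd p), (1 - 1 / (p : ℝ)) with hP
  have hP0 : P ≠ 0 := by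
    rintro h
    rw [h] at htot
    have := Nat.totient_pos.2 hW
    have h' : (W.totient : ℝ) = 0 := by simpa using htot
    norm_cast at h'
    omega
  norm_num
  field_simp

lemma card_twin_primes_le {W : ℕ} (hWe : Even W) (hW : 0 < W) {b x y : ℕ}
    (hy : W ^ 2 ≤ y) (hy2 : 2 ≤ y) (hWx : W ≤ x) :
    (Nat.card {p : ℕ | p ≤ x ∧ p.Prime ∧ p ≡ b [MOD W] ∧ (p + 2).Prime} : ℝ) ≤
      64 * (x / W) * (W / (W.totient * Real.log y)) ^ 2 + 3 * (y : ℝ) ^ 12 := by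
  classical
  set D := y ^ 2 with hD
  set N := x / W + 1 with hN
  set b₀ := b % W with hb₀
  set S := (Finset.range N).filter fun m =>
    ∀ p, p.Prime → p ≤ D → ¬ p ∣ (b₀ + W * m) * (b₀ + W * m + 2) with hS
  have hsub : {p : ℕ | p ≤ x ∧ p.Prime ∧ p ≡ b [MOD W] ∧ (p + 2).Prime} ⊆
      ((Finset.Icc 1 D ∪ S.image fun m => b₀ + W * m : Finset ℕ) : Set ℕ) := by
    rintro n ⟨hnx, hn, hnb, hn2⟩
    simp only [Finset.coe_union, Set.mem_union, Finset.mem_coe, Finset.mem_Icc, Finset.mem_image]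
    by_cases hnD : n ≤ D
    · exact Or.inl ⟨hn.one_le, hnD⟩
    · right
      have hnW : b₀ + W * (n / W) = n := by
        rw [hb₀, ← (show n % W = b % W from hnb), Nat.mod_add_div]
      refine ⟨n / W, ?_, hnW⟩
      rw [hS, Finset.mem_filter, Finset.mem_range, hnW]
      refine ⟨Nat.lt_succ_of_le (Nat.div_le_div_right hnx), fun p hp hpD hdvd => ?_⟩
      rcases hp.dvd_mul.1 hdvd with h | h
      · have := (Nat.prime_dvd_prime_iff_eq hp hn).1 h
        omega
      · have := (Nat.prime_dvd_prime_iff_eq hp hn2).1 h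
        omega
  have hcard : (Nat.card {p : ℕ | p ≤ x ∧ p.Prime ∧ p ≡ b [MOD W] ∧ (p + 2).Prime} : ℝ) ≤
      D + S.card := by
    have h1 := Nat.card_mono (Finset.finite_toSet _) hsub
    rw [Nat.card_coe_set_eq, Nat.card_coe_set_eq, Set.ncard_coe_finset] at h1
    rw [Nat.card_coe_set_eq]
    have h2 := (h1.trans (Finset.card_union_le _ _)).trans
      (Nat.add_le_add_left Finset.card_image_le _)
    rw [Nat.card_Icc, Nat.add_sub_cancel] at h2
    exact_mod_cast h2
  have hsieve := twin_sieve_bound hWe b₀ N D (Nat.one_le_pow _ _ (by omega))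
    (Finset.filter_subset _ _) (S := S) fun m hm => (Finset.mem_filter.1 hm).2
  set G := ∑ d ∈ squarefreeCoprime W D, 2 ^ d.primeFactors.card / (d : ℝ)
  have hG : ((W.totient : ℝ) / W * Real.log y) ^ 2 ≤ 32 * G := sq_totient_mul_log_le hW hy
  have hW' : (0 : ℝ) < W := by exact_mod_cast hW
  have hφ : (0 : ℝ) < W.totient := by exact_mod_cast Nat.totient_pos.2 hW
  have hlog : 0 < Real.log y := Real.log_pos (by exact_mod_cast hy2)
  have hNle : (N : ℝ) ≤ 2 * (x / W) := by
    have h1 : ((x / W : ℕ) : ℝ) ≤ x / W := Nat.cast_div_le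
    have h2 : (1 : ℝ) ≤ x / W := by
      rw [one_le_div hW']
      exact_mod_cast hWx
    rw [hN]
    push_cast
    linarith
  have hmain : N / G ≤ 64 * (x / W) * (W / (W.totient * Real.log y)) ^ 2 := by
    have hpos : 0 < ((W.totient : ℝ) / W * Real.log y) ^ 2 := by positivity
    have hG' : ((W.totient : ℝ) / W * Real.log y) ^ 2 / 32 ≤ G := by linarith
    calc N / G ≤ 2 * (x / W) / (((W.totient : ℝ) / W * Real.log y) ^ 2 / 32) := by gcongr
      _ = _ := by
        field_simp
        ring
  have hD12 : (D : ℝ) + 2 * (D : ℝ) ^ 6 ≤ 3 * (y : ℝ) ^ 12 := by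
    have hy1 : (1 : ℝ) ≤ y := by exact_mod_cast (by omega : 1 ≤ y)
    have h1 : (y : ℝ) ^ 2 ≤ (y : ℝ) ^ 12 := pow_le_pow_right₀ hy1 (by norm_num)
    rw [hD]
    push_cast
    rw [← pow_mul]
    norm_num
    linarith
  linarith


/-- Twin-prime upper bound in an arithmetic progression: with an absolute
constant `C`, for even `W ≥ 2`, `b` coprime to `W`, and `x` large depending on
`W`, the number of primes `p ≤ x` with `p ≡ b (mod W)` and `p + 2` prime is at
most `C · x/(φ(W) log² x) · ∏_{p ∣ W, p odd} (1 - 1/p)⁻¹`. -/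
theorem stmt_18 :
    ∃ C : ℝ, 0 < C ∧ ∀ W : ℕ, Even W → 2 ≤ W → ∀ b : ℕ, Nat.Coprime b W →
      ∃ x₀ : ℕ, ∀ x : ℕ, x₀ ≤ x →
        (Nat.card {p : ℕ | p ≤ x ∧ p.Prime ∧ p ≡ b [MOD W] ∧ (p + 2).Prime} : ℝ)
          ≤ C * (x : ℝ) / (Nat.totient W * (Real.log x) ^ 2) *
              ∏ p ∈ W.primeFactors.filter (fun p => Odd p),
                (1 - 1 / (p : ℝ))⁻¹ := by
  refine ⟨2 * (64 * 6400 + 1), by norm_num, fun W hWe hW2 b _ => ?_⟩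
  have hW : 0 < W := by omega
  refine ⟨(W ^ 2 + 20000) ^ 40, fun x hx => ?_⟩
  have hx0 : x ≠ 0 := by
    have : 0 < (W ^ 2 + 20000) ^ 40 := by positivity
    omega
  obtain ⟨y, hyx, hxy⟩ : ∃ y : ℕ, y ^ 40 ≤ x ∧ x < (y + 1) ^ 40 :=
    ⟨_, Nat.pow_nthRoot_le (by norm_num), Nat.lt_pow_nthRoot_add_one (by norm_num) x⟩
  have hy : W ^ 2 + 20000 ≤ y := by
    have := lt_of_pow_lt_pow_left₀ 40 (Nat.zero_le _) (hx.trans_lt hxy)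
    omega
  clear hx
  have hWy : W ≤ y := by nlinarith only [hy]
  have hWx : W ≤ x := hWy.trans ((Nat.le_self_pow (by norm_num) y).trans hyx)
  have hcard := card_twin_primes_le hWe hW (b := b) (by omega : W ^ 2 ≤ y) (by omega) hWx
  refine hcard.trans ?_
  have hW' : (0 : ℝ) < W := by exact_mod_cast hW
  have hφ : (0 : ℝ) < W.totient := by exact_mod_cast Nat.totient_pos.2 hW
  have hφW : (W.totient : ℝ) ≤ W := by exact_mod_cast Nat.totient_le W
  have hyR : (20000 : ℝ) ≤ y := by exact_mod_cast (by omega : 20000 ≤ y)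
  have hWyR : (W : ℝ) ≤ y := by exact_mod_cast hWy
  have hxR : (0 : ℝ) < x := by exact_mod_cast hx0.bot_lt
  have hyxR : (y : ℝ) ^ 40 ≤ x := by exact_mod_cast hyx
  have hlogy : 0 < Real.log y := Real.log_pos (by linarith only [hyR])
  have hlogx : 0 < Real.log x := by
    have : (1 : ℝ) < (y : ℝ) ^ 40 := one_lt_pow₀ (by linarith only [hyR]) (by norm_num)
    exact Real.log_pos (this.trans_le hyxR)
  have hlog : Real.log x ≤ 80 * Real.log y := by
    have hxy' : (x : ℝ) ≤ ((y : ℝ) + 1) ^ 40 := by exact_mod_cast hxy.le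
    have h1 := Real.log_le_log hxR hxy'
    have hsq : (y : ℝ) + 1 ≤ (y : ℝ) ^ 2 := by nlinarith only [hyR]
    have h2 := Real.log_le_log (by linarith only [hyR]) hsq
    rw [Real.log_pow] at h1 h2
    push_cast at h1 h2
    linarith only [h1, h2]
  have hlogle : Real.log x ≤ 80 * y := by
    have := Real.log_le_self (by linarith : (0 : ℝ) ≤ y)
    linarith
  clear hxy hyx hcard hWx hx0
  have hP := self_div_totient_eq hWe hW
  set P := ∏ p ∈ W.primeFactors.filter (fun p => Odd p), (1 - 1 / (p : ℝ))⁻¹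
  have hP' : P = W / W.totient / 2 := by linarith
  have hmain : 64 * ((x : ℝ) / W) * (W / (W.totient * Real.log y)) ^ 2 ≤
      64 * 6400 * (x * W / (W.totient ^ 2 * Real.log x ^ 2)) := by
    calc 64 * ((x : ℝ) / W) * (W / (W.totient * Real.log y)) ^ 2
        ≤ 64 * ((x : ℝ) / W) * (W / (W.totient * (Real.log x / 80))) ^ 2 := by
          gcongr
          linarith
      _ = _ := by
          field_simp
          ring
  have herr : 3 * (y : ℝ) ^ 12 ≤ x * W / (W.totient ^ 2 * Real.log x ^ 2) := by
    rw [le_div_iff₀ (by positivity)]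
    calc 3 * (y : ℝ) ^ 12 * (W.totient ^ 2 * Real.log x ^ 2)
        ≤ 3 * (y : ℝ) ^ 12 * (W ^ 2 * (80 * y) ^ 2) := by gcongr
      _ = 19200 * (y : ℝ) ^ 14 * W * W := by ring
      _ ≤ y * (y : ℝ) ^ 14 * y * W := by
          gcongr
          linarith
      _ = (y : ℝ) ^ 16 * W := by ring
      _ ≤ (y : ℝ) ^ 40 * W := by
          gcongr
          · linarith
          · norm_num
      _ ≤ x * W := by gcongr
  calc _ ≤ (64 * 6400 + 1) * (x * W / (W.totient ^ 2 * Real.log x ^ 2)) := by linarith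
    _ = _ := by
      rw [hP']
      field_simp
end
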